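/- Let Σ(A,B,C,G) be a C^∞-BIBO stable system node with finite-dimensional input and output spaces. Then there exists a Borel measure h of bounded total variation on [0,∞) with values in the d_Y × d_U complex matrices such that: (1) for every classical solution (u,x,y) with u ∈ C_c^∞((0,∞),U) and x(0) = 0 one has y = h ∗ u; and (2) the Laplace transform of h equals G on the half-plane C_{ω(T)}. -/

import Mathlib

/-- A bundled complex Banach space (declared before `open MeasureTheory`, whose
notations interfere with instance-binder fields in structures). -/
structure CplxBanach where
  carrier : Type
  [nacg : NormedAddCommGroup carrier]
  [nsp : NormedSpace ℂ carrier]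
  [cs : CompleteSpace carrier]

attribute [instance] CplxBanach.nacg CplxBanach.nsp CplxBanach.cs

/-- A bundled complex Hilbert space. -/
structure CplxHilbert where
  carrier : Type
  [nacg : NormedAddCommGroup carrier]
  [ips : InnerProductSpace ℂ carrier]
  [cs : CompleteSpace carrier]

attribute [instance] CplxHilbert.nacg CplxHilbert.ips CplxHilbert.cs

open MeasureTheory Set
open scoped ENNReal NNReal Topology

noncomputable section

/-- A strongly continuous semigroup of bounded linear operators on a complex Banach space. -/
structure C0Semigroup (X : Type*) [NormedAddCommGroup X] [NormedSpace ℂ X] where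
  T : ℝ → X →L[ℂ] X
  map_zero : T 0 = ContinuousLinearMap.id ℂ X
  map_add : ∀ s t : ℝ, 0 ≤ s → 0 ≤ t → T (s + t) = (T s).comp (T t)
  strongly_continuous : ∀ x : X, ContinuousOn (fun t => T t x) (Set.Ici 0)

namespace C0Semigroup

variable {X : Type*} [NormedAddCommGroup X] [NormedSpace ℂ X]

/-- The growth bound `ω(T)` of a strongly continuous semigroup. -/
def growthBound (S : C0Semigroup X) : ℝ :=
  sInf {w : ℝ | ∃ M : ℝ, ∀ t : ℝ, 0 ≤ t → ‖S.T t‖ ≤ M * Real.exp (w * t)}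

/-- Exponential stability of a strongly continuous semigroup. -/
def ExpStable (S : C0Semigroup X) : Prop :=
  ∃ ε : ℝ, 0 < ε ∧ ∃ M : ℝ, ∀ t : ℝ, 0 ≤ t → ‖S.T t‖ ≤ M * Real.exp (-ε * t)

/-- The semigroup is analytic: it extends analytically to an open sector around the
positive real axis, the extension satisfying the semigroup property on the sector. -/
def IsAnalytic (S : C0Semigroup X) : Prop :=
  ∃ θ : ℝ, θ ∈ Set.Ioo 0 (Real.pi / 2) ∧ ∃ F : ℂ → X →L[ℂ] X,
    DifferentiableOn ℂ F {z : ℂ | z ≠ 0 ∧ |Complex.arg z| < θ} ∧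
    (∀ t : ℝ, 0 < t → F t = S.T t) ∧
    (∀ z w : ℂ, (z ≠ 0 ∧ |Complex.arg z| < θ) → (w ≠ 0 ∧ |Complex.arg w| < θ) →
      F (z + w) = (F z).comp (F w))

/-- The fractional power `(-A)^{-γ}` of the negative generator of an exponentially
stable semigroup, defined through the standard integral formula
`(-A)^{-γ} = Γ(γ)⁻¹ ∫_0^∞ t^{γ-1} T(t) dt` (and the identity for `γ = 0`). -/
def negAPow (S : C0Semigroup X) (γ : ℝ) : X →L[ℂ] X :=
  if γ = 0 then ContinuousLinearMap.id ℂ X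
  else (Real.Gamma γ)⁻¹ • ∫ t in Set.Ioi (0:ℝ), t ^ (γ - 1) • S.T t

end C0Semigroup

/-- A system node `Σ(A,B,C,G)` on the Banach spaces `(U, X, Y)`, in the sense of Staffans.
The extrapolation space `X_{-1}` is given as the space `Xm1` together with a dense
continuous embedding `ι : X → X_{-1}`; `Am1 : X → X_{-1}` is the extension
`A_{-1}` of the generator restricted to `X` (which is bounded from `X` to `X_{-1}`);
the domain of `A` is the set of `x ∈ X` with `A_{-1} x ∈ X`.  `R s` is the resolvent
`(s - A_{-1})^{-1} : X_{-1} → X`, defined (as specified by `R_right`, `R_left`) for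
`Re s > ω(T)`.  `B : U → X_{-1}` is the control operator and `Cop` is the observation
operator `C : X_1 → Y`, encoded as a map on all of `X` that is linear and
`X_1`-bounded on the domain of `A`.  `G` is the transfer function. -/
structure SystemNode (U : Type*) (X : Type*) (Xm1 : Type*) (Y : Type*)
    [NormedAddCommGroup U] [NormedSpace ℂ U]
    [NormedAddCommGroup X] [NormedSpace ℂ X]
    [NormedAddCommGroup Xm1] [NormedSpace ℂ Xm1]
    [NormedAddCommGroup Y] [NormedSpace ℂ Y] where
  S : C0Semigroup X
  Sm1 : C0Semigroup Xm1
  ι : X →L[ℂ] Xm1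
  ι_injective : Function.Injective (fun x : X => ι x)
  ι_dense : DenseRange (fun x : X => ι x)
  semigroup_compat : ∀ t : ℝ, 0 ≤ t → ∀ x : X, Sm1.T t (ι x) = ι (S.T t x)
  Am1 : X →L[ℂ] Xm1
  generator : ∀ x : X, ∀ t : ℝ, 0 ≤ t →
    HasDerivWithinAt (fun τ : ℝ => ι (S.T τ x)) (Am1 (S.T t x)) (Set.Ici 0) t
  B : U →L[ℂ] Xm1
  Cop : X → Y
  Cop_add : ∀ x₁ x₂ : X, (∃ z : X, Am1 x₁ = ι z) → (∃ z : X, Am1 x₂ = ι z) →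
    Cop (x₁ + x₂) = Cop x₁ + Cop x₂
  Cop_smul : ∀ (a : ℂ) (x : X), (∃ z : X, Am1 x = ι z) → Cop (a • x) = a • Cop x
  Cop_bound : ∃ M : ℝ, ∀ x z : X, Am1 x = ι z → ‖Cop x‖ ≤ M * (‖x‖ + ‖z‖)
  R : ℂ → Xm1 →L[ℂ] X
  R_right : ∀ s : ℂ, S.growthBound < s.re → ∀ w : Xm1, s • ι (R s w) - Am1 (R s w) = w
  R_left : ∀ s : ℂ, S.growthBound < s.re → ∀ x : X, R s (s • ι x - Am1 x) = x
  G : ℂ → U →L[ℂ] Y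
  G_analytic : DifferentiableOn ℂ (fun s => G s) {s : ℂ | S.growthBound < s.re}
  G_shift : ∀ α β : ℂ, S.growthBound < α.re → S.growthBound < β.re → ∀ u : U,
    G α u - G β u = Cop (R α (B u) - R β (B u))

namespace SystemNode

variable {U X Xm1 Y : Type*}
  [NormedAddCommGroup U] [NormedSpace ℂ U]
  [NormedAddCommGroup X] [NormedSpace ℂ X]
  [NormedAddCommGroup Xm1] [NormedSpace ℂ Xm1]
  [NormedAddCommGroup Y] [NormedSpace ℂ Y]

/-- The domain of the generator `A`: those `x ∈ X` with `A_{-1} x ∈ X`. -/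
def domA (sys : SystemNode U X Xm1 Y) : Set X := {x : X | ∃ z : X, sys.Am1 x = sys.ι z}

/-- A fixed point in the half-plane of analyticity of the transfer function. -/
def betaPt (sys : SystemNode U X Xm1 Y) : ℂ := ((sys.S.growthBound + 1 : ℝ) : ℂ)

/-- The combined observation/feedthrough operator
`C&D (x,u) = C[x - (β - A)⁻¹ B u] + G(β) u`. -/
def CD (sys : SystemNode U X Xm1 Y) (x : X) (u : U) : Y :=
  sys.Cop (x - sys.R sys.betaPt (sys.B u)) + sys.G sys.betaPt u

/-- The pair `(x,u)` belongs to the domain of the combined operator `C&D`,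
i.e. `A_{-1} x + B u ∈ X`. -/
def memCD (sys : SystemNode U X Xm1 Y) (x : X) (u : U) : Prop :=
  ∃ z : X, sys.Am1 x + sys.B u = sys.ι z

/-- A classical solution `(u,x,y)` of the system node on `[0,∞)`:
`u, y` continuous, `x` continuously differentiable with
`ẋ(t) = A x(t) + B u(t)` (in particular `(x(t),u(t)) ∈ D(C&D)`) and
`y(t) = C&D (x(t),u(t))` for all `t ≥ 0`. -/
def IsClassicalSolution (sys : SystemNode U X Xm1 Y)
    (u : ℝ → U) (x : ℝ → X) (y : ℝ → Y) : Prop :=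
  ContinuousOn u (Set.Ici 0) ∧ ContinuousOn y (Set.Ici 0) ∧
  (∃ x' : ℝ → X, ContinuousOn x' (Set.Ici 0) ∧
    (∀ t ∈ Set.Ici (0:ℝ), HasDerivWithinAt x (x' t) (Set.Ici 0) t) ∧
    (∀ t ∈ Set.Ici (0:ℝ), sys.Am1 (x t) + sys.B (u t) = sys.ι (x' t))) ∧
  (∀ t ∈ Set.Ici (0:ℝ), y t = sys.CD (x t) (u t))

/-- `C^∞`-BIBO stability: there is `c > 0` such that every classical solution with
zero initial state and smooth input compactly supported in `(0,∞)` has output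
bounded by `c` times the sup-norm of the input. -/
def CInfBIBOStable (sys : SystemNode U X Xm1 Y) : Prop :=
  ∃ c : ℝ, 0 < c ∧ ∀ (u : ℝ → U) (x : ℝ → X) (y : ℝ → Y),
    sys.IsClassicalSolution u x y → x 0 = 0 →
    ContDiff ℝ (⊤ : ℕ∞) u → HasCompactSupport u → tsupport u ⊆ Set.Ioi 0 →
    ∀ M : ℝ, (∀ s : ℝ, ‖u s‖ ≤ M) → ∀ t : ℝ, 0 ≤ t → ‖y t‖ ≤ c * M

/-- The state part of a generalised solution in the distributional sense:
`u ∈ L¹_loc`, `x` continuous `X_{-1}`-valued, given by the variation of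
constants formula with initial state `x₀ ∈ X`. -/
def IsMildState (sys : SystemNode U X Xm1 Y) (x₀ : X) (u : ℝ → U) (xs : ℝ → Xm1) : Prop :=
  MeasureTheory.LocallyIntegrableOn u (Set.Ici 0) ∧
  ContinuousOn xs (Set.Ici 0) ∧
  ∀ t : ℝ, 0 ≤ t →
    IntervalIntegrable (fun s => sys.Sm1.T (t - s) (sys.B (u s))) MeasureTheory.volume 0 t ∧
    xs t = sys.Sm1.T t (sys.ι x₀) + ∫ s in (0:ℝ)..t, sys.Sm1.T (t - s) (sys.B (u s))

/-- The output part of a generalised solution in the distributional sense: the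
(locally integrable representative of the) `Y`-valued distribution
`y = d²/dt² ( C&D ∫_0^t (t-s) (x(s), u(s)) ds )`. -/
def IsGenOutput (sys : SystemNode U X Xm1 Y) (u : ℝ → U) (xs : ℝ → Xm1) (y : ℝ → Y) : Prop :=
  MeasureTheory.LocallyIntegrableOn y (Set.Ici 0) ∧
  ∃ (K : ℝ → X) (L : ℝ → U),
    (∀ t : ℝ, 0 ≤ t → sys.ι (K t) = ∫ s in (0:ℝ)..t, (t - s) • xs s) ∧
    (∀ t : ℝ, 0 ≤ t → L t = ∫ s in (0:ℝ)..t, (t - s) • u s) ∧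
    (∀ t : ℝ, 0 ≤ t → sys.memCD (K t) (L t)) ∧
    (∀ φ : ℝ → ℝ, ContDiff ℝ (⊤ : ℕ∞) φ → HasCompactSupport φ → tsupport φ ⊆ Set.Ioi 0 →
      ∫ t in Set.Ioi (0:ℝ), deriv (deriv φ) t • sys.CD (K t) (L t) =
        ∫ t in Set.Ioi (0:ℝ), φ t • y t)

/-- A generalised solution in the distributional sense. -/
def IsGeneralizedSolution (sys : SystemNode U X Xm1 Y) (x₀ : X)
    (u : ℝ → U) (xs : ℝ → Xm1) (y : ℝ → Y) : Prop :=
  sys.IsMildState x₀ u xs ∧ sys.IsGenOutput u xs y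

/-- `L^∞`-BIBO stability: there is `c > 0` such that for every generalised solution in
the distributional sense with zero initial state and locally essentially bounded input,
the output is represented by a locally essentially bounded function with
`‖y‖_{L^∞([0,t])} ≤ c ‖u‖_{L^∞([0,t])}` for all `t > 0`. -/
def LInfBIBOStable (sys : SystemNode U X Xm1 Y) : Prop :=
  ∃ c : ℝ, 0 < c ∧ ∀ (u : ℝ → U) (xs : ℝ → Xm1),
    sys.IsMildState 0 u xs →
    (∀ t : ℝ, 0 < t → ∃ M : ℝ,
      ∀ᵐ s ∂(MeasureTheory.volume.restrict (Set.Ioc (0:ℝ) t)), ‖u s‖ ≤ M) →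
    ∃ y : ℝ → Y, sys.IsGenOutput u xs y ∧
      ∀ t : ℝ, 0 < t → ∀ M : ℝ,
        (∀ᵐ s ∂(MeasureTheory.volume.restrict (Set.Ioc (0:ℝ) t)), ‖u s‖ ≤ M) →
        (∀ᵐ s ∂(MeasureTheory.volume.restrict (Set.Ioc (0:ℝ) t)), ‖y s‖ ≤ c * M)

/-- `L^p`-control-admissibility of the control operator `B`. -/
def ControlAdmissible (sys : SystemNode U X Xm1 Y) (p : ℝ≥0∞) : Prop :=
  ∀ t : ℝ, 0 < t → ∃ M : ℝ, ∀ u : ℝ → U,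
    IntervalIntegrable (fun s => sys.Sm1.T (t - s) (sys.B (u s))) MeasureTheory.volume 0 t →
    ∃ x : X, sys.ι x = ∫ s in (0:ℝ)..t, sys.Sm1.T (t - s) (sys.B (u s)) ∧
      ‖x‖ ≤ M * (eLpNorm u p (MeasureTheory.volume.restrict (Set.Ioc (0:ℝ) t))).toReal

/-- Infinite-time `L^p`-control-admissibility: the admissibility constant can be chosen
uniformly in `t`. -/
def InfTimeControlAdmissible (sys : SystemNode U X Xm1 Y) (p : ℝ≥0∞) : Prop :=
  ∃ M : ℝ, ∀ t : ℝ, 0 < t → ∀ u : ℝ → U,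
    IntervalIntegrable (fun s => sys.Sm1.T (t - s) (sys.B (u s))) MeasureTheory.volume 0 t →
    ∃ x : X, sys.ι x = ∫ s in (0:ℝ)..t, sys.Sm1.T (t - s) (sys.B (u s)) ∧
      ‖x‖ ≤ M * (eLpNorm u p (MeasureTheory.volume.restrict (Set.Ioc (0:ℝ) t))).toReal

/-- `L^p`-observation-admissibility of the observation operator `C`. -/
def ObservationAdmissible (sys : SystemNode U X Xm1 Y) (p : ℝ≥0∞) : Prop :=
  ∃ t : ℝ, 0 < t ∧ ∃ M : ℝ, ∀ x z : X, sys.Am1 x = sys.ι z →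
    (eLpNorm (fun s : ℝ => sys.Cop (sys.S.T s x)) p
      (MeasureTheory.volume.restrict (Set.Ioc (0:ℝ) t))).toReal ≤ M * ‖x‖

/-- `L²`-well-posedness of a system node: `B` and `C` are `L²`-admissible and the
transfer function is bounded on some right half-plane. -/
def L2WellPosed (sys : SystemNode U X Xm1 Y) : Prop :=
  sys.ControlAdmissible 2 ∧ sys.ObservationAdmissible 2 ∧
  ∃ w : ℝ, sys.S.growthBound ≤ w ∧ ∃ M : ℝ, ∀ s : ℂ, w < s.re → ‖sys.G s‖ ≤ M

end SystemNode

/-- A (matrix/operator valued) Borel measure of bounded total variation on `[0,∞)`,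
encoded through its polar decomposition: a finite positive measure `μ` supported on
`[0,∞)` together with a density `g` of norm one. -/
structure BVMeasure (U Y : Type*) [NormedAddCommGroup U] [NormedSpace ℂ U]
    [NormedAddCommGroup Y] [NormedSpace ℂ Y] where
  μ : MeasureTheory.Measure ℝ
  finite : MeasureTheory.IsFiniteMeasure μ
  supported : μ (Set.Iio 0) = 0
  g : ℝ → U →L[ℂ] Y
  g_meas : MeasureTheory.AEStronglyMeasurable g μ
  g_norm : ∀ᵐ t ∂μ, ‖g t‖ = 1

namespace BVMeasure

variable {U Y : Type*} [NormedAddCommGroup U] [NormedSpace ℂ U]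
  [NormedAddCommGroup Y] [NormedSpace ℂ Y]

/-- The total variation `‖h‖_M` of the measure. -/
def var (h : BVMeasure U Y) : ℝ := (h.μ Set.univ).toReal

/-- The Laplace transform `ĥ(s) u = ∫ e^{-st} dh(t) u`. -/
def laplace (h : BVMeasure U Y) (s : ℂ) (u : U) : Y :=
  ∫ t, Complex.exp (-(s * t)) • (h.g t u) ∂h.μ

/-- The convolution `(h ∗ u)(t) = ∫_{[0,t]} dh(s) u(t - s)`. -/
def conv (h : BVMeasure U Y) (u : ℝ → U) (t : ℝ) : Y :=
  ∫ s in Set.Icc 0 t, (h.g s) (u (t - s)) ∂h.μ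

end BVMeasure

/-- The Laplace transform of `h` coincides with the transfer function of the node on
the half-plane `ℂ_{ω(T)}` (on `ℂ_{ω(T)} ∩ ℂ_0`, identifying `ĥ` with its analytic
continuation). -/
def LaplaceMatches {U X Xm1 Y : Type*}
    [NormedAddCommGroup U] [NormedSpace ℂ U]
    [NormedAddCommGroup X] [NormedSpace ℂ X]
    [NormedAddCommGroup Xm1] [NormedSpace ℂ Xm1]
    [NormedAddCommGroup Y] [NormedSpace ℂ Y]
    (sys : SystemNode U X Xm1 Y) (h : BVMeasure U Y) : Prop :=
  ∀ s : ℂ, sys.S.growthBound < s.re → 0 ≤ s.re → ∀ u : U, h.laplace s u = sys.G s u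

/-- `sys'` is a system node for the multiplicatively perturbed triple `(AP, B, C)`. -/
def IsMultPerturbed {U X Xm1 Y : Type*}
    [NormedAddCommGroup U] [NormedSpace ℂ U]
    [NormedAddCommGroup X] [NormedSpace ℂ X]
    [NormedAddCommGroup Xm1] [NormedSpace ℂ Xm1]
    [NormedAddCommGroup Y] [NormedSpace ℂ Y]
    (sys sys' : SystemNode U X Xm1 Y) (P : X →L[ℂ] X) : Prop :=
  sys'.ι = sys.ι ∧ sys'.Am1 = sys.Am1.comp P ∧ sys'.B = sys.B ∧ sys'.Cop = sys.Cop

/-- `sys'` is a system node for the additively perturbed triple `(A + P, B, C)`. -/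
def IsAddPerturbed {U X Xm1 Y : Type*}
    [NormedAddCommGroup U] [NormedSpace ℂ U]
    [NormedAddCommGroup X] [NormedSpace ℂ X]
    [NormedAddCommGroup Xm1] [NormedSpace ℂ Xm1]
    [NormedAddCommGroup Y] [NormedSpace ℂ Y]
    (sys sys' : SystemNode U X Xm1 Y) (P : X →L[ℂ] X) : Prop :=
  sys'.ι = sys.ι ∧ sys'.Am1 = sys.Am1 + sys.ι.comp P ∧ sys'.B = sys.B ∧ sys'.Cop = sys.Cop

end
/-! ### Representation of bounded functionals -/

theorem hb_factor {V E : Type*} [AddCommGroup V] [Module ℂ V] [NormedAddCommGroup E]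
    [NormedSpace ℂ E] (J : V →ₗ[ℂ] E) (l : V →ₗ[ℂ] ℂ) (C : ℝ)
    (h : ∀ v, ‖l v‖ ≤ C * ‖J v‖) : ∃ L : StrongDual ℂ E, ∀ v, L (J v) = l v := by
  have hk : LinearMap.ker J ≤ LinearMap.ker l := by
    intro v hv
    have := h v
    rw [LinearMap.mem_ker.1 hv] at this
    simpa using this
  let f : LinearMap.range J →ₗ[ℂ] ℂ :=
    ((LinearMap.ker J).liftQ l hk).comp (J.quotKerEquivRange.symm : _ →ₗ[ℂ] _)
  have hf : ∀ v, f ⟨J v, LinearMap.mem_range_self J v⟩ = l v := by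
    intro v
    have : J.quotKerEquivRange.symm ⟨J v, LinearMap.mem_range_self J v⟩
        = Submodule.Quotient.mk v := by
      rw [LinearEquiv.symm_apply_eq]
      rfl
    simp [f, this]
  have hb : ∀ x : LinearMap.range J, ‖f x‖ ≤ C * ‖x‖ := by
    rintro ⟨_, v, rfl⟩
    have := h v
    rw [← hf v] at this
    exact this
  obtain ⟨L, hL, -⟩ := exists_extension_norm_eq (LinearMap.range J) (f.mkContinuous C hb)
  refine ⟨L, fun v => ?_⟩
  have := hL ⟨J v, LinearMap.mem_range_self J v⟩
  rw [← hf v, ← LinearMap.mkContinuous_apply f C hb, ← this]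

open BoundedContinuousFunction CompactlySupported in
theorem split_bcf (f₁ f₂ : C_c(ℝ, ℝ≥0)) (g : ℝ →ᵇ ℂ) (hg : ∀ x, ‖g x‖ ≤ (f₁ x : ℝ) + f₂ x) :
    ∃ g₁ : ℝ →ᵇ ℂ, (∀ x, ‖g₁ x‖ ≤ f₁ x) ∧ (∀ x, ‖g x - g₁ x‖ ≤ f₂ x) := by
  let q : ℝ → ℝ := fun x => (f₁ x : ℝ) / ((f₁ x : ℝ) + f₂ x)
  have c1 : Continuous fun x => (f₁ x : ℝ) := NNReal.continuous_coe.comp f₁.continuous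
  have c2 : Continuous fun x => (f₂ x : ℝ) := NNReal.continuous_coe.comp f₂.continuous
  have hq0 : ∀ x, 0 ≤ q x := fun x => by positivity
  have hq1 : ∀ x, q x ≤ 1 := fun x => div_le_one_of_le₀ (by simp) (by positivity)
  have key1 : ∀ x, ‖(q x : ℂ) * g x‖ ≤ f₁ x := by
    intro x
    rw [norm_mul, Complex.norm_real, Real.norm_of_nonneg (hq0 x)]
    refine (mul_le_mul_of_nonneg_left (hg x) (hq0 x)).trans ?_
    by_cases h : (f₁ x : ℝ) + f₂ x = 0
    · rw [h]; simp
    · simp only [q]; rw [div_mul_cancel₀ _ h]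
  have key2 : ∀ x, ‖g x - (q x : ℂ) * g x‖ ≤ f₂ x := by
    intro x
    have : g x - (q x : ℂ) * g x = ((1 - q x : ℝ) : ℂ) * g x := by push_cast; ring
    rw [this, norm_mul, Complex.norm_real, Real.norm_of_nonneg (by linarith [hq1 x])]
    refine (mul_le_mul_of_nonneg_left (hg x) (by linarith [hq1 x])).trans ?_
    by_cases h : (f₁ x : ℝ) + f₂ x = 0
    · rw [h]; simp
    · simp only [q]; rw [sub_mul, div_mul_cancel₀ _ h]; simp
  have hc : Continuous fun x => (q x : ℂ) * g x := by
    rw [continuous_iff_continuousAt]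
    intro x
    by_cases h : (f₁ x : ℝ) + f₂ x = 0
    · have hx : (q x : ℂ) * g x = 0 := by simp [q, h]
      change Filter.Tendsto (fun x => (q x : ℂ) * g x) (𝓝 x) (𝓝 ((q x : ℂ) * g x))
      rw [hx]
      apply squeeze_zero_norm key1
      have h1 : (f₁ x : ℝ) = 0 := by
        have := (f₁ x).coe_nonneg; have := (f₂ x).coe_nonneg; linarith
      have := c1.tendsto x
      rwa [h1] at this
    · refine ContinuousAt.mul ?_ g.continuous.continuousAt
      exact Complex.continuous_ofReal.continuousAt.comp
        (c1.continuousAt.div (c1.add c2).continuousAt h)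
  refine ⟨BoundedContinuousFunction.ofNormedAddCommGroup _ hc ‖g‖ (fun x => ?_), key1, key2⟩
  rw [norm_mul, Complex.norm_real, Real.norm_of_nonneg (hq0 x)]
  have := mul_le_mul (hq1 x) (g.norm_coe_le_norm x) (norm_nonneg _) zero_le_one
  simpa using this

open BoundedContinuousFunction CompactlySupported in
/-- The variation functional. -/
noncomputable def tvSet (L : StrongDual ℂ (ℝ →ᵇ ℂ)) (f : C_c(ℝ, ℝ≥0)) : Set ℝ≥0 :=
  {r | ∃ g : ℝ →ᵇ ℂ, (∀ x, ‖g x‖ ≤ f x) ∧ r = ‖L g‖₊}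

open BoundedContinuousFunction CompactlySupported in
theorem tv_bound (L : StrongDual ℂ (ℝ →ᵇ ℂ)) (f : C_c(ℝ, ℝ≥0)) (c : ℝ≥0) (hc : ∀ x, f x ≤ c)
    (r : ℝ≥0) (hr : r ∈ tvSet L f) : r ≤ ‖L‖₊ * c := by
  obtain ⟨g, hg, rfl⟩ := hr
  refine (L.le_opNNNorm g).trans (mul_le_mul_right ?_ _)
  rw [← NNReal.coe_le_coe, coe_nnnorm]
  exact (BoundedContinuousFunction.norm_le c.2).2 fun x => (hg x).trans (by exact_mod_cast hc x)

open BoundedContinuousFunction CompactlySupported in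
theorem cc_bdd (f : C_c(ℝ, ℝ≥0)) : ∃ c : ℝ≥0, ∀ x, f x ≤ c := by
  have h : HasCompactSupport fun x => (f x : ℝ) :=
    f.hasCompactSupport.comp_left (g := fun z : ℝ≥0 => (z : ℝ)) rfl
  obtain ⟨c, hc⟩ := h.exists_bound_of_continuous (NNReal.continuous_coe.comp f.continuous)
  refine ⟨c.toNNReal, fun x => ?_⟩
  have := hc x
  rw [Real.norm_of_nonneg (NNReal.coe_nonneg _)] at this
  exact NNReal.le_toNNReal_of_coe_le this

open BoundedContinuousFunction CompactlySupported in
theorem tv_bdd (L : StrongDual ℂ (ℝ →ᵇ ℂ)) (f : C_c(ℝ, ℝ≥0)) : BddAbove (tvSet L f) := by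
  obtain ⟨c, hc⟩ := cc_bdd f
  exact ⟨_, fun r hr => tv_bound L f c hc r hr⟩

open BoundedContinuousFunction CompactlySupported in
theorem tv_nonempty (L : StrongDual ℂ (ℝ →ᵇ ℂ)) (f : C_c(ℝ, ℝ≥0)) : (tvSet L f).Nonempty :=
  ⟨0, 0, by simp, by simp⟩

open BoundedContinuousFunction CompactlySupported in
theorem tv_phase (L : StrongDual ℂ (ℝ →ᵇ ℂ)) (g : ℝ →ᵇ ℂ) :
    ∃ g' : ℝ →ᵇ ℂ, (∀ x, ‖g' x‖ ≤ ‖g x‖) ∧ L g' = (‖L g‖ : ℂ) := by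
  by_cases h : L g = 0
  · exact ⟨g, fun _ => le_rfl, by simp [h]⟩
  · refine ⟨((‖L g‖ : ℂ) / L g) • g, fun x => ?_, ?_⟩
    · simp [h]
    · rw [map_smul, smul_eq_mul, div_mul_cancel₀ _ h]

open BoundedContinuousFunction CompactlySupported in
theorem tv_add (L : StrongDual ℂ (ℝ →ᵇ ℂ)) (f₁ f₂ : C_c(ℝ, ℝ≥0)) :
    sSup (tvSet L (f₁ + f₂)) = sSup (tvSet L f₁) + sSup (tvSet L f₂) := by
  apply le_antisymm
  · refine csSup_le (tv_nonempty _ _) ?_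
    rintro r ⟨g, hg, rfl⟩
    obtain ⟨g₁, h1, h2⟩ := split_bcf f₁ f₂ g (fun x => by simpa using hg x)
    have e : L g = L g₁ + L (g - g₁) := by rw [← map_add]; simp
    rw [e]
    refine (nnnorm_add_le _ _).trans (add_le_add ?_ ?_)
    · exact le_csSup (tv_bdd _ _) ⟨g₁, h1, rfl⟩
    · exact le_csSup (tv_bdd _ _) ⟨g - g₁, h2, rfl⟩
  · have key : ∀ r₁ ∈ tvSet L f₁, ∀ r₂ ∈ tvSet L f₂, r₁ + r₂ ≤ sSup (tvSet L (f₁ + f₂)) := ?_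
    · have h1 : ∀ r₁ ∈ tvSet L f₁, r₁ + sSup (tvSet L f₂) ≤ sSup (tvSet L (f₁ + f₂)) := by
        intro r₁ hr₁
        have h0 : r₁ ≤ sSup (tvSet L (f₁ + f₂)) := by
          simpa using key r₁ hr₁ 0 ⟨0, by simp, by simp⟩
        refine add_le_of_le_tsub_left_of_le h0 (csSup_le (tv_nonempty _ _) fun r₂ hr₂ => ?_)
        exact le_tsub_of_add_le_left (key r₁ hr₁ r₂ hr₂)
      have h0 : sSup (tvSet L f₂) ≤ sSup (tvSet L (f₁ + f₂)) := by
        simpa using h1 0 ⟨0, by simp, by simp⟩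
      refine add_le_of_le_tsub_right_of_le h0 (csSup_le (tv_nonempty _ _) fun r₂ hr₂ => ?_)
      exact le_tsub_of_add_le_right (h1 r₂ hr₂)
    rintro _ ⟨g₁, h1, rfl⟩ _ ⟨g₂, h2, rfl⟩
    obtain ⟨a, ha, ha'⟩ := tv_phase L g₁
    obtain ⟨b, hb, hb'⟩ := tv_phase L g₂
    refine le_csSup (tv_bdd _ _) ⟨a + b, fun x => ?_, ?_⟩
    · have := norm_add_le (a x) (b x)
      have := ha x; have := hb x; have := h1 x; have := h2 x
      simp only [coe_add, Pi.add_apply, CompactlySupportedContinuousMap.coe_add, NNReal.coe_add]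
      linarith
    · rw [map_add, ha', hb', ← Complex.ofReal_add, ← NNReal.coe_inj]
      simp only [NNReal.coe_add, coe_nnnorm, Complex.norm_real]
      rw [Real.norm_of_nonneg (by positivity)]

open BoundedContinuousFunction CompactlySupported in
theorem tv_smul (L : StrongDual ℂ (ℝ →ᵇ ℂ)) (c : ℝ≥0) (f : C_c(ℝ, ℝ≥0)) :
    sSup (tvSet L (c • f)) = c * sSup (tvSet L f) := by
  have key : ∀ (c : ℝ≥0) (f : C_c(ℝ, ℝ≥0)), c * sSup (tvSet L f) ≤ sSup (tvSet L (c • f)) := by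
    intro c f
    rw [sSup_eq_iSup', NNReal.mul_iSup]
    have : Nonempty (tvSet L f) := (tv_nonempty L f).to_subtype
    refine ciSup_le ?_
    rintro ⟨_, g, hg, rfl⟩
    refine le_csSup (tv_bdd _ _) ⟨(c : ℂ) • g, fun x => ?_, ?_⟩
    · have := mul_le_mul_of_nonneg_left (hg x) c.coe_nonneg
      simpa using this
    · rw [map_smul, nnnorm_smul]; simp
  by_cases hc : c = 0
  · subst hc
    rw [zero_mul, ← nonpos_iff_eq_zero]
    refine csSup_le (tv_nonempty _ _) fun r hr => ?_
    simpa using tv_bound L _ 0 (by simp) r hr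
  apply le_antisymm _ (key c f)
  have := key c⁻¹ (c • f)
  rw [inv_smul_smul₀ hc] at this
  calc _ = c * (c⁻¹ * sSup (tvSet L (c • f))) := by rw [mul_inv_cancel_left₀ hc]
    _ ≤ _ := by gcongr

open BoundedContinuousFunction CompactlySupported in
theorem tv_measure (L : StrongDual ℂ (ℝ →ᵇ ℂ)) : ∃ μ : Measure ℝ, IsFiniteMeasure μ ∧
    ∀ g : ℝ →ᵇ ℂ, HasCompactSupport g → ‖L g‖ ≤ ∫ x, ‖g x‖ ∂μ := by
  let N : C_c(ℝ, ℝ≥0) →ₗ[ℝ≥0] ℝ≥0 :=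
    { toFun := fun f => sSup (tvSet L f)
      map_add' := tv_add L
      map_smul' := tv_smul L }
  refine ⟨NNRealRMK.rieszMeasure N, ⟨?_⟩, ?_⟩
  · refine lt_of_le_of_lt ?_ (ENNReal.coe_lt_top (r := ‖L‖₊))
    rw [isOpen_univ.measure_eq_iSup_isCompact]
    refine iSup₂_le fun K _ => iSup_le fun hK => ?_
    obtain ⟨f, hf1, -, hf3, hf4⟩ := exists_continuous_one_zero_of_isCompact hK isClosed_empty
      (disjoint_empty K)
    let F : C_c(ℝ, ℝ≥0) := ⟨⟨fun x => (f x).toNNReal, by fun_prop⟩,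
      hf3.comp_left (g := Real.toNNReal) Real.toNNReal_zero⟩
    have h1 := NNRealRMK.lintegral_rieszMeasure N F
    have h2 : N F ≤ ‖L‖₊ := by
      refine csSup_le (tv_nonempty _ _) fun r hr => ?_
      simpa using tv_bound L F 1 (fun x => Real.toNNReal_le_one.2 (hf4 x).2) r hr
    calc NNRealRMK.rieszMeasure N K = ∫⁻ x, K.indicator 1 x ∂NNRealRMK.rieszMeasure N := by
          rw [lintegral_indicator_one hK.measurableSet]
      _ ≤ ∫⁻ x, F x ∂NNRealRMK.rieszMeasure N := by
          refine lintegral_mono fun x => ?_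
          by_cases hx : x ∈ K
          · have : F x = 1 := by
              change (f x).toNNReal = 1
              rw [hf1 hx]; simp
            simp [hx, this]
          · simp [hx]
      _ = N F := h1
      _ ≤ _ := by exact_mod_cast h2
  · intro g hg
    let f : C_c(ℝ, ℝ≥0) := ⟨⟨fun x => ‖g x‖₊, by fun_prop⟩, hg.comp_left (g := fun z => ‖z‖₊) (by simp)⟩
    have h1 := NNRealRMK.integral_rieszMeasure N f
    have h2 : ‖L g‖₊ ≤ N f := le_csSup (tv_bdd _ _) ⟨g, fun x => le_rfl, rfl⟩
    calc ‖L g‖ ≤ N f := by exact_mod_cast h2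
      _ = _ := by rw [← h1]; rfl

/-- Smooth compactly supported functions. -/
def testSp : Submodule ℂ (ℝ → ℂ) where
  carrier := {φ | ContDiff ℝ (⊤ : ℕ∞) φ ∧ HasCompactSupport φ}
  add_mem' := fun ha hb => ⟨ha.1.add hb.1, ha.2.add hb.2⟩
  zero_mem' := ⟨contDiff_const, HasCompactSupport.zero⟩
  smul_mem' := fun c _ ha => ⟨ha.1.const_smul c, ha.2.smul_left (f := fun _ => c)⟩

theorem testSp_memLp (μ : Measure ℝ) [IsFiniteMeasure μ] (φ : testSp) (p : ℝ≥0∞) :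
    MemLp (φ : ℝ → ℂ) p μ :=
  φ.2.1.continuous.memLp_of_hasCompactSupport φ.2.2

open BoundedContinuousFunction in
theorem rep_tv (l : testSp →ₗ[ℂ] ℂ) (C : ℝ)
    (h : ∀ (φ : testSp) (M : ℝ), (∀ x, ‖(φ : ℝ → ℂ) x‖ ≤ M) → ‖l φ‖ ≤ C * M) :
    ∃ μ : Measure ℝ, IsFiniteMeasure μ ∧ ∀ φ : testSp, ‖l φ‖ ≤ ∫ x, ‖(φ : ℝ → ℂ) x‖ ∂μ := by
  have hb : ∀ φ : testSp, ∃ M, ∀ x, ‖(φ : ℝ → ℂ) x‖ ≤ M := fun φ =>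
    φ.2.2.exists_bound_of_continuous φ.2.1.continuous
  let J : testSp →ₗ[ℂ] (ℝ →ᵇ ℂ) :=
    { toFun := fun φ => BoundedContinuousFunction.ofNormedAddCommGroup (φ : ℝ → ℂ)
        φ.2.1.continuous (hb φ).choose (hb φ).choose_spec
      map_add' := fun a b => by ext x; rfl
      map_smul' := fun a b => by ext x; rfl }
  obtain ⟨L, hL⟩ := hb_factor J l C (fun φ => h φ _ fun x => (J φ).norm_coe_le_norm x)
  obtain ⟨μ, h1, h2⟩ := tv_measure L
  refine ⟨μ, h1, fun φ => ?_⟩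
  rw [← hL]
  exact h2 (J φ) φ.2.2

theorem rep_l2 (μ : Measure ℝ) [IsFiniteMeasure μ] (l : testSp →ₗ[ℂ] ℂ)
    (h : ∀ φ : testSp, ‖l φ‖ ≤ ∫ x, ‖(φ : ℝ → ℂ) x‖ ∂μ) :
    ∃ k : ℝ → ℂ, Integrable k μ ∧ ∀ φ : testSp, l φ = ∫ x, (φ : ℝ → ℂ) x * k x ∂μ := by
  let J : testSp →ₗ[ℂ] Lp ℂ 2 μ :=
    { toFun := fun φ => (testSp_memLp μ φ 2).toLp _
      map_add' := fun a b => MemLp.toLp_add _ _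
      map_smul' := fun a b => MemLp.toLp_const_smul _ _ }
  have hJ : ∀ φ : testSp, ‖l φ‖ ≤ ((μ univ) ^ (1 / 2 : ℝ)).toReal * ‖J φ‖ := by
    intro φ
    refine (h φ).trans ?_
    have h1 := eLpNorm_le_eLpNorm_mul_rpow_measure_univ (μ := μ) (p := 1) (q := 2)
      (by norm_num) (testSp_memLp μ φ 2).1
    have h2 := ENNReal.toReal_mono (by
      refine ENNReal.mul_ne_top (testSp_memLp μ φ 2).2.ne ?_
      exact ENNReal.rpow_ne_top_of_nonneg (by norm_num) (measure_ne_top _ _)) h1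
    rw [ENNReal.toReal_mul, eLpNorm_one_eq_lintegral_enorm,
      ← integral_norm_eq_lintegral_enorm (testSp_memLp μ φ 2).1] at h2
    refine h2.trans (le_of_eq ?_)
    rw [mul_comm]
    congr 1
    · norm_num
    · exact (Lp.norm_toLp _ (testSp_memLp μ φ 2)).symm
  obtain ⟨L, hL⟩ := hb_factor J l _ hJ
  let w := (InnerProductSpace.toDual ℂ (Lp ℂ 2 μ)).symm L
  refine ⟨fun x => starRingEnd ℂ (w x), ?_, fun φ => ?_⟩
  · have : MemLp w 2 μ := Lp.memLp w
    exact (Complex.conjCLE : ℂ →L[ℝ] ℂ).integrable_comp (this.integrable (by norm_num))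
  · rw [← hL, ← InnerProductSpace.toDual_symm_apply, L2.inner_def]
    refine integral_congr_ae ?_
    filter_upwards [(testSp_memLp μ φ 2).coeFn_toLp] with x hx
    rw [show (J φ : ℝ → ℂ) x = (φ : ℝ → ℂ) x from hx]
    rfl

/-- Smooth cutoff. -/
noncomputable def cutL (n : ℕ) (x : ℝ) : ℝ := Real.smoothTransition (1 + n * x)

theorem rep_final {I : Type*} [Fintype I] (l : I → testSp →ₗ[ℂ] ℂ) (C : I → ℝ)
    (h : ∀ i (φ : testSp) (M : ℝ), (∀ x, ‖(φ : ℝ → ℂ) x‖ ≤ M) → ‖l i φ‖ ≤ C i * M)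
    (hs : ∀ i (φ : testSp), (∀ x, 0 ≤ x → (φ : ℝ → ℂ) x = 0) → l i φ = 0) :
    ∃ μ : Measure ℝ, IsFiniteMeasure μ ∧ μ (Iio 0) = 0 ∧ ∃ k : I → ℝ → ℂ,
      ∀ i, Integrable (k i) μ ∧ ∀ φ : testSp, l i φ = ∫ x, (φ : ℝ → ℂ) x * k i x ∂μ := by
  choose m hm1 hm2 using fun i => rep_tv (l i) (C i) (h i)
  let ν : Measure ℝ := ∑ i, m i
  have hν : IsFiniteMeasure ν := inferInstance
  have hb : ∀ i (φ : testSp), ‖l i φ‖ ≤ ∫ x, ‖(φ : ℝ → ℂ) x‖ ∂ν := by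
    intro i φ
    refine (hm2 i φ).trans ?_
    refine integral_mono_measure ?_ (Filter.Eventually.of_forall fun x => norm_nonneg _) ?_
    · exact Finset.single_le_sum (f := m) (fun j _ => Measure.zero_le _) (Finset.mem_univ i)
    · exact ((testSp_memLp ν φ 1).integrable le_rfl).norm
  choose k hk1 hk2 using fun i => rep_l2 ν (l i) (hb i)
  refine ⟨ν.restrict (Ici 0), inferInstance, ?_, k, fun i => ⟨(hk1 i).mono_measure
    Measure.restrict_le_self, fun φ => ?_⟩⟩
  · rw [Measure.restrict_apply measurableSet_Iio,
      show Iio (0:ℝ) ∩ Ici 0 = ∅ by ext x; simp, measure_empty]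
  · have hc : ∀ n, ContDiff ℝ (⊤ : ℕ∞) fun x => (cutL n x : ℂ) := fun n =>
      Complex.ofRealCLM.contDiff.comp (Real.smoothTransition.contDiff.comp (by fun_prop))
    let ψ : ℕ → testSp := fun n => ⟨fun x => (cutL n x : ℂ) * (φ : ℝ → ℂ) x,
      (hc n).mul φ.2.1, φ.2.2.mul_left⟩
    have e : ∀ n, ∫ x, (ψ n : ℝ → ℂ) x * k i x ∂ν = l i φ := by
      intro n
      rw [← hk2]
      have := hs i (ψ n - φ) (by
        intro x hx
        have : cutL n x = 1 := Real.smoothTransition.one_of_one_le (by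
          have : 0 ≤ (n : ℝ) * x := by positivity
          linarith)
        change (cutL n x : ℂ) * (φ : ℝ → ℂ) x - (φ : ℝ → ℂ) x = 0
        rw [this]; simp)
      rwa [map_sub, sub_eq_zero] at this
    have hlim : Filter.Tendsto (fun n => ∫ x, (ψ n : ℝ → ℂ) x * k i x ∂ν) Filter.atTop
        (𝓝 (∫ x, (Ici (0:ℝ)).indicator (fun x => (φ : ℝ → ℂ) x * k i x) x ∂ν)) := by
      obtain ⟨M, hM⟩ := φ.2.2.exists_bound_of_continuous φ.2.1.continuous
      refine tendsto_integral_of_dominated_convergence (fun x => M * ‖k i x‖) ?_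
        ((hk1 i).norm.const_mul M) ?_ ?_
      · exact fun n => (ψ n).2.1.continuous.aestronglyMeasurable.mul (hk1 i).1
      · intro n
        refine Filter.Eventually.of_forall fun x => ?_
        rw [norm_mul]
        refine mul_le_mul_of_nonneg_right ?_ (norm_nonneg _)
        change ‖(cutL n x : ℂ) * (φ : ℝ → ℂ) x‖ ≤ M
        rw [norm_mul, Complex.norm_real, Real.norm_of_nonneg
          (show 0 ≤ cutL n x from Real.smoothTransition.nonneg _)]
        exact (mul_le_of_le_one_left (norm_nonneg _) (Real.smoothTransition.le_one _)).trans (hM x)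
      · refine Filter.Eventually.of_forall fun x => ?_
        by_cases hx : 0 ≤ x
        · rw [indicator_of_mem (by exact hx)]
          refine tendsto_const_nhds.congr fun n => ?_
          have : cutL n x = 1 := Real.smoothTransition.one_of_one_le (by
            have : 0 ≤ (n : ℝ) * x := by positivity
            linarith)
          change _ = (cutL n x : ℂ) * (φ : ℝ → ℂ) x * k i x
          rw [this]; simp
        · rw [indicator_of_notMem (by exact hx)]
          refine tendsto_const_nhds.congr' ?_
          obtain ⟨N, hN⟩ := exists_nat_ge (1 / (-x))
          filter_upwards [Filter.eventually_ge_atTop N] with n hn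
          have : cutL n x = 0 := Real.smoothTransition.zero_of_nonpos (by
            push Not at hx
            have h1 : (1 / (-x)) ≤ n := hN.trans (by exact_mod_cast hn)
            rw [div_le_iff₀ (by linarith)] at h1
            linarith)
          change _ = (cutL n x : ℂ) * (φ : ℝ → ℂ) x * k i x
          rw [this]; simp
    simp only [e] at hlim
    rw [tendsto_nhds_unique tendsto_const_nhds hlim, integral_indicator measurableSet_Ici]

/-! ### Semigroup estimates -/

section semigroup

variable {X : Type*} [NormedAddCommGroup X] [NormedSpace ℂ X]

theorem C0Semigroup.growth_nonempty [CompleteSpace X] (S : C0Semigroup X) :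
    {w : ℝ | ∃ M : ℝ, ∀ t : ℝ, 0 ≤ t → ‖S.T t‖ ≤ M * Real.exp (w * t)}.Nonempty := by
  obtain ⟨C₀, hC₀⟩ := banach_steinhaus (g := fun t : Icc (0:ℝ) 1 => S.T t) (by
    intro x
    obtain ⟨C, hC⟩ := isCompact_Icc.exists_bound_of_continuousOn
      ((S.strongly_continuous x).mono (Icc_subset_Ici_self : Icc (0:ℝ) 1 ⊆ Ici 0))
    exact ⟨C, fun t => hC t t.2⟩)
  let C := max C₀ 1
  have hC1 : 1 ≤ C := le_max_right _ _
  have hC : ∀ t, 0 ≤ t → t ≤ 1 → ‖S.T t‖ ≤ C := fun t h0 h1 =>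
    (hC₀ ⟨t, h0, h1⟩).trans (le_max_left _ _)
  have key : ∀ n : ℕ, ∀ t : ℝ, 0 ≤ t → t ≤ n + 1 → ‖S.T t‖ ≤ C ^ (n + 1) := by
    intro n
    induction n with
    | zero => intro t h0 h1; simpa using hC t h0 (by simpa using h1)
    | succ n ih =>
      intro t h0 h1
      push_cast at h1
      by_cases h : t ≤ 1
      · refine (hC t h0 h).trans ?_
        exact le_self_pow₀ hC1 (by simp)
      · push Not at h
        have e : t = 1 + (t - 1) := by ring
        rw [e, S.map_add 1 (t - 1) zero_le_one (by linarith), pow_succ']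
        refine (ContinuousLinearMap.opNorm_comp_le _ _).trans ?_
        exact mul_le_mul (hC 1 zero_le_one le_rfl) (ih _ (by linarith) (by linarith))
          (norm_nonneg _) (by linarith)
  refine ⟨Real.log C, C, fun t ht => ?_⟩
  have h1 := key ⌊t⌋₊ t ht (Nat.lt_floor_add_one t).le
  refine h1.trans ?_
  rw [pow_succ']
  refine mul_le_mul_of_nonneg_left ?_ (by linarith)
  rw [← Real.exp_log (show 0 < C by linarith), ← Real.exp_nat_mul, Real.exp_log (by linarith)]
  refine Real.exp_le_exp.2 ?_
  rw [mul_comm]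
  exact mul_le_mul_of_nonneg_left (Nat.floor_le ht) (Real.log_nonneg hC1)

theorem C0Semigroup.exp_bound [CompleteSpace X] (S : C0Semigroup X) (w : ℝ)
    (hw : S.growthBound < w) :
    ∃ M : ℝ, 0 ≤ M ∧ ∀ t : ℝ, 0 ≤ t → ‖S.T t‖ ≤ M * Real.exp (w * t) := by
  obtain ⟨w', ⟨M, hM⟩, h2⟩ := exists_lt_of_csInf_lt S.growth_nonempty hw
  have hM0 : 0 ≤ M := by
    have := (norm_nonneg _).trans (hM 0 le_rfl)
    simpa using this
  refine ⟨M, hM0, fun t ht => (hM t ht).trans ?_⟩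
  gcongr

/-- The orbit integral. -/
noncomputable def C0Semigroup.Z (S : C0Semigroup X) (p : X) (φ : ℝ → ℂ) : X :=
  ∫ s in Ioi (0:ℝ), φ s • S.T s p

variable (S : C0Semigroup X) (p : X)

theorem C0Semigroup.locInt :
    LocallyIntegrable ((Ioi (0:ℝ)).indicator fun s => S.T s p) volume := by
  rw [locallyIntegrable_iff]
  intro K hK
  obtain ⟨b, hb⟩ := hK.bddAbove
  rw [IntegrableOn, integrable_indicator_iff measurableSet_Ioi, IntegrableOn,
    Measure.restrict_restrict measurableSet_Ioi]
  have h1 : IntegrableOn (fun s => S.T s p) (Icc 0 b) :=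
    ((S.strongly_continuous p).mono Icc_subset_Ici_self).integrableOn_compact isCompact_Icc
  exact h1.mono_set fun x hx => ⟨le_of_lt hx.1, hb hx.2⟩

theorem C0Semigroup.Z_integrable (φ : ℝ → ℂ) (h1 : Continuous φ) (h2 : HasCompactSupport φ) :
    IntegrableOn (fun s => φ s • S.T s p) (Ioi (0:ℝ)) := by
  rw [← integrable_indicator_iff measurableSet_Ioi]
  have := (S.locInt p).integrable_smul_left_of_hasCompactSupport h1 h2
  refine this.congr (Filter.Eventually.of_forall fun x => ?_)
  by_cases hx : x ∈ Ioi (0:ℝ) <;> simp [hx]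

theorem C0Semigroup.conv_eq (g : ℝ → ℂ) (t : ℝ) :
    (convolution ((Ioi (0:ℝ)).indicator fun s => S.T s p) g
      ((ContinuousLinearMap.lsmul ℝ ℂ : ℂ →L[ℝ] X →L[ℝ] X).flip) volume) t
      = S.Z p (fun s => g (t - s)) := by
  rw [C0Semigroup.Z, ← integral_indicator measurableSet_Ioi]
  refine integral_congr_ae (Filter.Eventually.of_forall fun x => ?_)
  by_cases hx : x ∈ Ioi (0:ℝ) <;> simp [hx]

theorem C0Semigroup.Z_hasDerivAt [CompleteSpace X] (g : ℝ → ℂ) (h1 : ContDiff ℝ 1 g)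
    (h2 : HasCompactSupport g) (t : ℝ) :
    HasDerivAt (fun t => S.Z p (fun s => g (t - s))) (S.Z p (fun s => deriv g (t - s))) t := by
  have := h2.hasDerivAt_convolution_right
    ((ContinuousLinearMap.lsmul ℝ ℂ : ℂ →L[ℝ] X →L[ℝ] X).flip) (S.locInt p) h1 t
  rw [S.conv_eq] at this
  convert this using 1
  ext t
  rw [S.conv_eq]

theorem C0Semigroup.Z_continuous [CompleteSpace X] (g : ℝ → ℂ) (h1 : Continuous g)
    (h2 : HasCompactSupport g) :
    Continuous (fun t => S.Z p (fun s => g (t - s))) := by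
  have := h2.continuous_convolution_right
    ((ContinuousLinearMap.lsmul ℝ ℂ : ℂ →L[ℝ] X →L[ℝ] X).flip) (S.locInt p) h1
  convert this using 1
  ext t
  rw [S.conv_eq]

theorem C0Semigroup.Z_tendsto [CompleteSpace X] (s : ℂ) (hs : S.growthBound < s.re)
    (f : ℕ → ℝ → ℂ) (f₀ : ℝ → ℂ)
    (hf : ∀ n, Continuous (f n)) (D : ℝ) (hD : ∀ n t, 0 < t → ‖f n t‖ ≤ D * Real.exp (-(s.re * t)))
    (hlim : ∀ t, 0 < t → Filter.Tendsto (fun n => f n t) Filter.atTop (𝓝 (f₀ t))) :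
    Filter.Tendsto (fun n => S.Z p (f n)) Filter.atTop (𝓝 (S.Z p f₀)) := by
  obtain ⟨w, hw1, hw2⟩ := exists_between hs
  obtain ⟨M, hM0, hM⟩ := S.exp_bound w hw1
  have hD0 : 0 ≤ D := by
    have := (norm_nonneg _).trans (hD 0 1 one_pos)
    exact nonneg_of_mul_nonneg_left this (Real.exp_pos _)
  refine tendsto_integral_of_dominated_convergence
    (fun t => D * M * ‖p‖ * Real.exp (-(s.re - w) * t)) ?_ ?_ ?_ ?_
  · intro n
    refine ContinuousOn.aestronglyMeasurable ?_ measurableSet_Ioi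
    exact (hf n).continuousOn.smul ((S.strongly_continuous p).mono Ioi_subset_Ici_self)
  · exact (exp_neg_integrableOn_Ioi 0 (by linarith)).const_mul _
  · intro n
    filter_upwards [ae_restrict_mem measurableSet_Ioi] with t ht
    rw [norm_smul]
    have h1 := hD n t ht
    have h2 := ((S.T t).le_opNorm p).trans
      (mul_le_mul_of_nonneg_right (hM t (le_of_lt ht)) (norm_nonneg p))
    refine (mul_le_mul h1 h2 (norm_nonneg _) (by positivity)).trans (le_of_eq ?_)
    rw [show -(s.re - w) * t = -(s.re * t) + w * t by ring, Real.exp_add]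
    ring
  · filter_upwards [ae_restrict_mem measurableSet_Ioi] with t ht
    exact (hlim t ht).smul_const _

end semigroup

/-! ### System node -/

section node

variable {U X Xm1 Y : Type*}
  [NormedAddCommGroup U] [NormedSpace ℂ U]
  [NormedAddCommGroup X] [NormedSpace ℂ X] [CompleteSpace X]
  [NormedAddCommGroup Xm1] [NormedSpace ℂ Xm1] [CompleteSpace Xm1]
  [NormedAddCommGroup Y] [NormedSpace ℂ Y]
  (sys : SystemNode U X Xm1 Y)

theorem smooth_deriv {g : ℝ → ℂ} (h : ContDiff ℝ (⊤ : ℕ∞) g) : ContDiff ℝ (⊤ : ℕ∞) (deriv g) :=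
  (contDiff_infty_iff_deriv.1 h).2

theorem smooth_hasDerivAt {g : ℝ → ℂ} (h : ContDiff ℝ (⊤ : ℕ∞) g) (t : ℝ) :
    HasDerivAt g (deriv g t) t :=
  ((contDiff_infty_iff_deriv.1 h).1 t).hasDerivAt

omit [CompleteSpace X] [CompleteSpace Xm1] in
theorem SystemNode.beta_re : sys.S.growthBound < sys.betaPt.re := by
  simp [SystemNode.betaPt]

theorem SystemNode.Am1_Z (p : X) (φ : ℝ → ℂ) (h1 : ContDiff ℝ (⊤ : ℕ∞) φ)
    (h2 : HasCompactSupport φ) :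
    sys.Am1 (sys.S.Z p φ) = sys.ι (-(φ 0 • p) - sys.S.Z p (deriv φ)) := by
  have i1 := sys.S.Z_integrable p φ h1.continuous h2
  have i2 := sys.S.Z_integrable p (deriv φ) (smooth_deriv h1).continuous h2.deriv
  have j1 := sys.Am1.integrable_comp i1
  have j2 := sys.ι.integrable_comp i2
  have main : ∫ s in Ioi (0:ℝ), (sys.Am1 (φ s • sys.S.T s p) + sys.ι (deriv φ s • sys.S.T s p))
      = 0 - φ 0 • sys.ι (sys.S.T 0 p) := by
    refine integral_Ioi_of_hasDerivAt_of_tendsto (f := fun s => φ s • sys.ι (sys.S.T s p))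
      ?_ ?_ (j1.add j2) ?_
    · refine h1.continuous.continuousWithinAt.smul ?_
      exact sys.ι.continuous.continuousAt.comp_continuousWithinAt
        (sys.S.strongly_continuous p 0 self_mem_Ici)
    · intro s hs
      have d1 := (sys.generator p s (le_of_lt hs)).hasDerivAt (Ici_mem_nhds hs)
      have := (smooth_hasDerivAt h1 s).smul d1
      rw [map_smul, map_smul]
      exact this
    · obtain ⟨b, hb⟩ := h2.isCompact.bddAbove
      refine tendsto_const_nhds.congr' ?_
      filter_upwards [Filter.eventually_gt_atTop b] with s hs
      have : φ s = 0 := image_eq_zero_of_notMem_tsupport fun hx => absurd (hb hx) (by simpa using hs)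
      simp [this]
  rw [integral_add j1 j2, sys.Am1.integral_comp_comm i1, sys.ι.integral_comp_comm i2,
    sys.S.map_zero] at main
  change sys.Am1 (sys.S.Z p φ) + sys.ι (sys.S.Z p (deriv φ)) = _ at main
  rw [eq_sub_of_add_eq main]
  simp

omit [CompleteSpace X] [CompleteSpace Xm1] in
theorem SystemNode.Cop_sub' {a a' b b' : X} (ha : sys.Am1 a = sys.ι a') (hb : sys.Am1 b = sys.ι b') :
    sys.Cop (a - b) = sys.Cop a - sys.Cop b := by
  have h1 : sys.Am1 ((-1 : ℂ) • b) = sys.ι ((-1 : ℂ) • b') := by rw [map_smul, map_smul, hb]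
  have := sys.Cop_add a ((-1 : ℂ) • b) ⟨_, ha⟩ ⟨_, h1⟩
  rw [sys.Cop_smul _ b ⟨_, hb⟩] at this
  simpa [sub_eq_add_neg] using this

omit [CompleteSpace X] [CompleteSpace Xm1] in
theorem SystemNode.Cop_zero : sys.Cop 0 = 0 := by
  have := sys.Cop_smul 0 0 ⟨0, by simp⟩
  simpa using this

omit [CompleteSpace X] [CompleteSpace Xm1] in
theorem SystemNode.Cop_tendsto {α : Type*} {F : Filter α} {a a' : α → X} {b b' : X}
    (ha : ∀ n, sys.Am1 (a n) = sys.ι (a' n)) (hb : sys.Am1 b = sys.ι b')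
    (h : Filter.Tendsto a F (𝓝 b)) (h' : Filter.Tendsto a' F (𝓝 b')) :
    Filter.Tendsto (fun n => sys.Cop (a n)) F (𝓝 (sys.Cop b)) := by
  obtain ⟨M, hM⟩ := sys.Cop_bound
  rw [tendsto_iff_norm_sub_tendsto_zero] at h h' ⊢
  have h3 := (h.add h').const_mul M
  rw [add_zero, mul_zero] at h3
  refine squeeze_zero (fun _ => norm_nonneg _) (fun n => ?_) h3
  rw [← sys.Cop_sub' (ha n) hb]
  exact hM _ _ (by rw [map_sub, map_sub, ha, hb])

/-- The impulse response functional. -/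
noncomputable def SystemNode.lam (v : U) (ψ : ℝ → ℂ) : Y :=
  sys.Cop (sys.S.Z (sys.R sys.betaPt (sys.B v)) (fun s => sys.betaPt * ψ s + deriv ψ s))
    + ψ 0 • sys.G sys.betaPt v

theorem q_smooth (β : ℂ) {ψ : ℝ → ℂ} (h : ContDiff ℝ (⊤ : ℕ∞) ψ) (h2 : HasCompactSupport ψ) :
    ContDiff ℝ (⊤ : ℕ∞) (fun s => β * ψ s + deriv ψ s) ∧
    HasCompactSupport (fun s => β * ψ s + deriv ψ s) :=
  ⟨(contDiff_const.mul h).add (smooth_deriv h), (h2.mul_left (f := fun _ => β)).add h2.deriv⟩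

theorem SystemNode.lam_add (v : U) (ψ₁ ψ₂ : testSp) :
    sys.lam v (ψ₁ + ψ₂ : testSp) = sys.lam v ψ₁ + sys.lam v ψ₂ := by
  set p := sys.R sys.betaPt (sys.B v) with hp
  obtain ⟨a1, a2⟩ := q_smooth sys.betaPt ψ₁.2.1 ψ₁.2.2
  obtain ⟨b1, b2⟩ := q_smooth sys.betaPt ψ₂.2.1 ψ₂.2.2
  have e : sys.S.Z p (fun s => sys.betaPt * (ψ₁ + ψ₂ : testSp).1 s + deriv (ψ₁ + ψ₂ : testSp).1 s)
      = sys.S.Z p (fun s => sys.betaPt * ψ₁.1 s + deriv ψ₁.1 s)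
        + sys.S.Z p (fun s => sys.betaPt * ψ₂.1 s + deriv ψ₂.1 s) := by
    rw [C0Semigroup.Z, C0Semigroup.Z, C0Semigroup.Z,
      ← integral_add (sys.S.Z_integrable p _ a1.continuous a2)
        (sys.S.Z_integrable p _ b1.continuous b2)]
    congr 1
    ext s
    have d : deriv (ψ₁ + ψ₂ : testSp).1 s = deriv ψ₁.1 s + deriv ψ₂.1 s :=
      ((smooth_hasDerivAt ψ₁.2.1 s).add (smooth_hasDerivAt ψ₂.2.1 s)).deriv
    have d' : (ψ₁ + ψ₂ : testSp).1 s = ψ₁.1 s + ψ₂.1 s := rfl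
    rw [d, d', ← add_smul]
    congr 1
    ring
  have d' : (ψ₁ + ψ₂ : testSp).1 0 = ψ₁.1 0 + ψ₂.1 0 := rfl
  rw [lam, lam, lam, e, sys.Cop_add _ _ ⟨_, sys.Am1_Z p _ a1 a2⟩ ⟨_, sys.Am1_Z p _ b1 b2⟩, d', add_smul]
  abel

theorem SystemNode.lam_smul (v : U) (c : ℂ) (ψ : testSp) :
    sys.lam v (c • ψ : testSp) = c • sys.lam v ψ := by
  set p := sys.R sys.betaPt (sys.B v) with hp
  obtain ⟨a1, a2⟩ := q_smooth sys.betaPt ψ.2.1 ψ.2.2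
  have e : sys.S.Z p (fun s => sys.betaPt * (c • ψ : testSp).1 s + deriv (c • ψ : testSp).1 s)
      = c • sys.S.Z p (fun s => sys.betaPt * ψ.1 s + deriv ψ.1 s) := by
    rw [C0Semigroup.Z, C0Semigroup.Z, ← integral_smul]
    congr 1
    ext s
    have d : deriv (c • ψ : testSp).1 s = c * deriv ψ.1 s :=
      ((smooth_hasDerivAt ψ.2.1 s).const_smul c).deriv
    have d' : (c • ψ : testSp).1 s = c * ψ.1 s := rfl
    rw [d, d', smul_smul]
    congr 1
    ring
  have d' : (c • ψ : testSp).1 0 = c * ψ.1 0 := rfl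
  rw [lam, lam, e, sys.Cop_smul _ _ ⟨_, sys.Am1_Z p _ a1 a2⟩, d', smul_add, smul_smul]

omit [CompleteSpace X] [CompleteSpace Xm1] in
theorem SystemNode.lam_supp (v : U) (ψ : testSp) (h : ∀ x, 0 ≤ x → (ψ : ℝ → ℂ) x = 0) :
    sys.lam v ψ = 0 := by
  have e : sys.S.Z (sys.R sys.betaPt (sys.B v)) (fun s => sys.betaPt * ψ.1 s + deriv ψ.1 s) = 0 := by
    refine setIntegral_eq_zero_of_forall_eq_zero fun s hs => ?_
    have d : deriv ψ.1 s = 0 := by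
      have : ψ.1 =ᶠ[𝓝 s] fun _ => 0 := by
        filter_upwards [Ioi_mem_nhds hs] with x hx using h x (le_of_lt hx)
      rw [this.deriv_eq]; simp
    change (sys.betaPt * ψ.1 s + deriv ψ.1 s) • _ = (0 : X)
    rw [d, h s (le_of_lt hs)]
    simp
  rw [lam, e, h 0 le_rfl, sys.Cop_zero]
  simp

theorem SystemNode.exists_solution (v : U) (g : testSp) (hg : tsupport (g : ℝ → ℂ) ⊆ Ioi 0) :
    ∃ x : ℝ → X, sys.IsClassicalSolution (fun t => (g : ℝ → ℂ) t • v) x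
      (fun t => sys.lam v (fun s => (g : ℝ → ℂ) (t - s))) ∧ x 0 = 0 := by
  obtain ⟨g, hg1, hg2⟩ := g
  simp only at hg ⊢
  set β := sys.betaPt with hβ
  set p := sys.R β (sys.B v) with hp
  let q : ℝ → ℂ := fun s => β * g s - deriv g s
  have q1 : ContDiff ℝ (⊤ : ℕ∞) q := (contDiff_const.mul hg1).sub (smooth_deriv hg1)
  have q2 : HasCompactSupport q := (hg2.mul_left (f := fun _ => β)).sub hg2.deriv
  have hz : ∀ x ≤ 0, g x = 0 := fun x hx =>
    image_eq_zero_of_notMem_tsupport fun h => absurd (hg h) (by simpa using hx)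
  have hz' : ∀ x ≤ 0, deriv g x = 0 := fun x hx =>
    image_eq_zero_of_notMem_tsupport fun h =>
      absurd (hg (tsupport_deriv_subset h)) (by simpa using hx)
  let z : ℝ → X := fun t => sys.S.Z p (fun s => q (t - s))
  let z' : ℝ → X := fun t => sys.S.Z p (fun s => deriv q (t - s))
  have hzc : Continuous z := sys.S.Z_continuous p q q1.continuous q2
  have hzc' : Continuous z' := sys.S.Z_continuous p _ (smooth_deriv q1).continuous q2.deriv
  have hA : ∀ t, sys.Am1 (z t) = sys.ι (-(q t • p) + z' t) := by
    intro t
    have := sys.Am1_Z p (fun s => q (t - s)) (q1.comp (contDiff_const.sub contDiff_id))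
      (q2.comp_homeomorph (Homeomorph.subLeft t))
    rw [this]
    congr 1
    have e : sys.S.Z p (deriv fun s => q (t - s)) = - z' t := by
      simp only [z', C0Semigroup.Z]
      rw [← integral_neg]
      congr 1
      ext s
      rw [deriv_comp_const_sub, neg_smul]
    rw [e, sub_neg_eq_add, sub_zero]
  have hlam : ∀ t, sys.lam v (fun s => g (t - s)) = sys.Cop (z t) + g t • sys.G β v := by
    intro t
    have e : (fun s => β * g (t - s) + deriv (fun s => g (t - s)) s) = fun s => q (t - s) := by
      ext s
      rw [deriv_comp_const_sub]; simp only [q]; ring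
    rw [SystemNode.lam, ← hβ, e, sub_zero]
  refine ⟨fun t => g t • p + z t, ⟨?_, ?_, ⟨fun t => deriv g t • p + z' t, ?_, ?_, ?_⟩, ?_⟩, ?_⟩
  · exact (hg1.continuous.smul continuous_const).continuousOn
  · refine Continuous.continuousOn ?_
    simp only [hlam]
    refine Continuous.add ?_ (hg1.continuous.smul continuous_const)
    rw [continuous_iff_continuousAt]
    intro t
    refine sys.Cop_tendsto hA (hA t) hzc.continuousAt ?_
    exact (((q1.continuous.smul continuous_const).neg).add hzc').continuousAt
  · exact (((smooth_deriv hg1).continuous.smul continuous_const).add hzc').continuousOn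
  · intro t _
    have d1 := (smooth_hasDerivAt hg1 t).smul_const p
    have d2 := sys.S.Z_hasDerivAt p q (q1.of_le (by exact_mod_cast le_top)) q2 t
    exact (d1.add d2).hasDerivWithinAt
  · intro t _
    have hr := sys.R_right β sys.beta_re (sys.B v)
    rw [← hp] at hr
    simp only [map_add, map_smul]
    rw [hA, ← hr]
    simp only [q, map_add, map_neg, map_sub, map_smul, sub_smul, smul_sub, mul_smul]
    rw [smul_comm β (g t) (sys.ι p)]
    abel
  · intro t _
    change sys.lam v (fun s => g (t - s)) = sys.CD (g t • p + z t) (g t • v)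
    rw [hlam, SystemNode.CD, ← hβ, map_smul, map_smul, map_smul, ← hp]
    simp
  · simp only
    rw [hz 0 le_rfl, zero_smul, zero_add]
    refine setIntegral_eq_zero_of_forall_eq_zero fun s hs => ?_
    have : (0:ℝ) - s ≤ 0 := by have : (0:ℝ) < s := hs; linarith
    simp only [q]
    rw [hz _ this, hz' _ this]
    simp

omit [CompleteSpace X] [CompleteSpace Xm1] in
theorem SystemNode.sol_lin {u₁ u₂ : ℝ → U} {x₁ x₂ : ℝ → X} {y₁ y₂ : ℝ → Y} (c : ℂ)
    (h₁ : sys.IsClassicalSolution u₁ x₁ y₁) (h₂ : sys.IsClassicalSolution u₂ x₂ y₂) :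
    sys.IsClassicalSolution (fun t => u₁ t + c • u₂ t) (fun t => x₁ t + c • x₂ t)
      (fun t => y₁ t + c • y₂ t) := by
  obtain ⟨a1, a2, ⟨a', a3, a4, a5⟩, a6⟩ := h₁
  obtain ⟨b1, b2, ⟨b', b3, b4, b5⟩, b6⟩ := h₂
  refine ⟨a1.add (b1.const_smul c), a2.add (b2.const_smul c), ⟨fun t => a' t + c • b' t,
    a3.add (b3.const_smul c), fun t ht => (a4 t ht).add ((b4 t ht).const_smul c), fun t ht => ?_⟩,
    fun t ht => ?_⟩
  · simp only [map_add, map_smul]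
    rw [← a5 t ht, ← b5 t ht, smul_add]
    abel
  · have key : ∀ (x : X) (u : U) (x' : X), sys.Am1 x + sys.B u = sys.ι x' →
        sys.Am1 (x - sys.R sys.betaPt (sys.B u))
          = sys.ι (x' - sys.betaPt • sys.R sys.betaPt (sys.B u)) := by
      intro x u x' h
      have hr := sys.R_right _ sys.beta_re (sys.B u)
      have aux : ∀ a b c : Xm1, a - b = c → b = a - c := by
        rintro a b c rfl
        abel
      have hr' := aux _ _ _ hr
      rw [map_sub, map_sub, ← h, map_smul, hr']
      abel
    have k1 := key _ _ _ (a5 t ht)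
    have k2 := key _ _ _ (b5 t ht)
    simp only
    rw [a6 t ht, b6 t ht, CD, CD, CD, smul_add, ← sys.Cop_smul _ _ ⟨_, k2⟩,
      map_add, map_add, map_add, map_smul, map_smul, map_smul]
    have k3 : sys.Am1 (c • (x₂ t - sys.R sys.betaPt (sys.B (u₂ t))))
        = sys.ι (c • (b' t - sys.betaPt • sys.R sys.betaPt (sys.B (u₂ t)))) := by
      rw [map_smul, k2, map_smul]
    rw [add_add_add_comm, ← sys.Cop_add _ _ ⟨_, k1⟩ ⟨_, k3⟩]
    congr 2
    rw [smul_sub]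
    abel

omit [CompleteSpace X] [CompleteSpace Xm1] in
theorem SystemNode.sol_zero :
    sys.IsClassicalSolution (fun _ => 0) (fun _ => 0) (fun _ => 0) := by
  refine ⟨continuousOn_const, continuousOn_const, ⟨fun _ => 0, continuousOn_const, fun t _ =>
    hasDerivWithinAt_const _ _ _, fun t _ => by simp⟩, fun t _ => ?_⟩
  simp [CD, sys.Cop_zero]

omit [CompleteSpace X] [CompleteSpace Xm1] in
theorem SystemNode.sol_sum {I : Type*} (s : Finset I) (u : I → ℝ → U) (x : I → ℝ → X)
    (y : I → ℝ → Y) (h : ∀ i, sys.IsClassicalSolution (u i) (x i) (y i)) :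
    sys.IsClassicalSolution (fun t => ∑ i ∈ s, u i t) (fun t => ∑ i ∈ s, x i t)
      (fun t => ∑ i ∈ s, y i t) := by
  classical
  induction s using Finset.induction_on with
  | empty => simpa using sys.sol_zero
  | insert a s ha ih =>
    have := sys.sol_lin 1 (h a) ih
    simpa [Finset.sum_insert ha] using this

omit [CompleteSpace X] [CompleteSpace Xm1] in
theorem SystemNode.sol_unique (hb : sys.CInfBIBOStable) {u : ℝ → U} {x₁ x₂ : ℝ → X} {y₁ y₂ : ℝ → Y}
    (h₁ : sys.IsClassicalSolution u x₁ y₁) (h₂ : sys.IsClassicalSolution u x₂ y₂)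
    (e₁ : x₁ 0 = 0) (e₂ : x₂ 0 = 0) (t : ℝ) (ht : 0 ≤ t) : y₁ t = y₂ t := by
  obtain ⟨c, -, hc⟩ := hb
  have h := sys.sol_lin (-1) h₁ h₂
  have e : (fun t => u t + (-1 : ℂ) • u t) = fun _ => 0 := by ext t; simp
  rw [e] at h
  have := hc _ _ _ h (by simp [e₁, e₂]) contDiff_const HasCompactSupport.zero
    (by simp [tsupport, Function.support]) 0 (by simp) t ht
  simpa [← sub_eq_add_neg, sub_eq_zero] using this

theorem SystemNode.lam_bound (hb : sys.CInfBIBOStable) : ∃ c : ℝ, ∀ (v : U) (ψ : testSp) (M : ℝ),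
    (∀ x, ‖(ψ : ℝ → ℂ) x‖ ≤ M) → ‖sys.lam v ψ‖ ≤ c * (M * ‖v‖) := by
  obtain ⟨c, -, hc⟩ := hb
  refine ⟨c, fun v ψ M hM => ?_⟩
  obtain ⟨b, hb⟩ := ψ.2.2.isCompact.bddAbove
  let t₀ := max b 0 + 1
  let g : testSp := ⟨fun s => (ψ : ℝ → ℂ) (t₀ - s), ψ.2.1.comp (contDiff_const.sub contDiff_id),
    ψ.2.2.comp_homeomorph (Homeomorph.subLeft t₀)⟩
  have hsupp : tsupport (g : ℝ → ℂ) ⊆ Ioi 0 := by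
    intro s hs
    have h1 : t₀ - s ∈ tsupport (ψ : ℝ → ℂ) :=
      tsupport_comp_subset_preimage (ψ : ℝ → ℂ) (f := fun s => t₀ - s) (by fun_prop) hs
    have h2 := hb h1
    have h3 := le_max_left b 0
    simp only [t₀] at h2
    simp only [mem_Ioi]
    linarith
  obtain ⟨x, hx, hx0⟩ := sys.exists_solution v g hsupp
  have := hc _ _ _ hx hx0 (g.2.1.smul contDiff_const) (g.2.2.smul_right)
    ((tsupport_smul_subset_left _ _).trans hsupp) (M * ‖v‖) (fun s => by
      rw [norm_smul]
      exact mul_le_mul_of_nonneg_right (hM _) (norm_nonneg _)) t₀ (by positivity)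
  simpa [g] using this

end node

section laplace

variable {U X Xm1 Y : Type*}
  [NormedAddCommGroup U] [NormedSpace ℂ U]
  [NormedAddCommGroup X] [NormedSpace ℂ X] [CompleteSpace X]
  [NormedAddCommGroup Xm1] [NormedSpace ℂ Xm1] [CompleteSpace Xm1]
  [NormedAddCommGroup Y] [NormedSpace ℂ Y]
  (sys : SystemNode U X Xm1 Y)

theorem hasDerivAt_E (s : ℂ) (t : ℝ) :
    HasDerivAt (fun t : ℝ => Complex.exp (-(s * t))) (-s * Complex.exp (-(s * t))) t := by
  have h1 : HasDerivAt (fun t : ℝ => -(s * (t : ℂ))) (-(s * 1)) t :=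
    ((Complex.ofRealCLM.hasDerivAt (x := t)).const_mul s).neg
  have := h1.cexp
  convert this using 1
  ring

theorem contDiff_E (s : ℂ) : ContDiff ℝ (⊤ : ℕ∞) (fun t : ℝ => Complex.exp (-(s * t))) :=
  ((contDiff_const.mul Complex.ofRealCLM.contDiff).neg).cexp

theorem norm_E (s : ℂ) (t : ℝ) : ‖Complex.exp (-(s * t))‖ = Real.exp (-(s.re * t)) := by
  rw [Complex.norm_exp]; simp

theorem hasDerivAt_cut (s : ℂ) (r : ℝ) {θ : ℝ → ℂ} (h : ContDiff ℝ (⊤ : ℕ∞) θ) (t : ℝ) :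
    HasDerivAt (fun t : ℝ => θ (r * t) * Complex.exp (-(s * t)))
      ((r * deriv θ (r * t) - s * θ (r * t)) * Complex.exp (-(s * t))) t := by
  have h1 : HasDerivAt (fun t : ℝ => θ (r * t)) (r * deriv θ (r * t)) t := by
    have a : HasDerivAt (fun t : ℝ => r * t) (r * 1) t := (hasDerivAt_id t).const_mul r
    have := (smooth_hasDerivAt h (r * t)).scomp t a
    rw [mul_one, Complex.real_smul] at this
    exact this
  have := h1.mul (hasDerivAt_E s t)
  refine this.congr_deriv ?_
  ring

theorem cut_mem (s : ℂ) (r : ℝ) (hr : r ≠ 0) {θ : ℝ → ℂ} (h : ContDiff ℝ (⊤ : ℕ∞) θ)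
    (h2 : HasCompactSupport θ) :
    (fun t : ℝ => θ (r * t) * Complex.exp (-(s * t))) ∈ testSp :=
  ⟨(h.comp (contDiff_const.mul contDiff_id)).mul (contDiff_E s),
    (h2.comp_homeomorph (Homeomorph.mulLeft₀ r hr)).mul_right⟩

theorem SystemNode.lam_cut_tendsto (v : U) (s : ℂ) (hs : sys.S.growthBound < s.re)
    {θ : ℝ → ℂ} (h : ContDiff ℝ (⊤ : ℕ∞) θ) (h2 : HasCompactSupport θ) (h0 : θ 0 = 1)
    (r : ℕ → ℝ) (r0 : ∀ n, 0 < r n) (r1 : ∀ n, r n ≤ 1) (rl : Filter.Tendsto r Filter.atTop (𝓝 0)) :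
    Filter.Tendsto (fun n => sys.lam v (fun t : ℝ => θ (r n * t) * Complex.exp (-(s * t))))
      Filter.atTop (𝓝 (sys.G s v)) := by
  set β := sys.betaPt with hβ
  set p := sys.R β (sys.B v) with hp
  have k1 := smooth_deriv h
  have k2 := smooth_deriv k1
  obtain ⟨D0, hD0⟩ := h2.exists_bound_of_continuous h.continuous
  obtain ⟨D1, hD1⟩ := h2.deriv.exists_bound_of_continuous k1.continuous
  obtain ⟨D2, hD2⟩ := h2.deriv.deriv.exists_bound_of_continuous k2.continuous
  have rn : ∀ n, ‖(r n : ℂ)‖ ≤ 1 := fun n => by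
    rw [Complex.norm_real, Real.norm_of_nonneg (r0 n).le]; exact r1 n
  have rlc : Filter.Tendsto (fun n => (r n : ℂ)) Filter.atTop (𝓝 0) := by
    have := (Complex.continuous_ofReal.tendsto 0).comp rl
    rw [Complex.ofReal_zero] at this
    exact this
  have lim : ∀ (f : ℝ → ℂ), Continuous f → ∀ t : ℝ,
      Filter.Tendsto (fun n => f (r n * t)) Filter.atTop (𝓝 (f 0)) := fun f hf t => by
    have := (hf.tendsto (0 * t)).comp (rl.mul_const t)
    rw [zero_mul] at this
    exact this
  let q : ℕ → ℝ → ℂ := fun n t =>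
    ((β - s) * θ (r n * t) + r n * deriv θ (r n * t)) * Complex.exp (-(s * t))
  let q' : ℕ → ℝ → ℂ := fun n t =>
    ((β - s) * (r n * deriv θ (r n * t) - s * θ (r n * t))
      + r n * (r n * deriv (deriv θ) (r n * t) - s * deriv θ (r n * t))) * Complex.exp (-(s * t))
  have hq : ∀ n, (fun t => β * (θ (r n * t) * Complex.exp (-(s * t)))
      + deriv (fun t : ℝ => θ (r n * t) * Complex.exp (-(s * t))) t) = q n := by
    intro n
    ext t
    rw [(hasDerivAt_cut s (r n) h t).deriv]
    simp only [q]
    ring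
  have hq' : ∀ n, deriv (q n) = q' n := by
    intro n
    ext t
    have := ((hasDerivAt_cut s (r n) h t).const_mul (β - s)).add
      ((hasDerivAt_cut s (r n) k1 t).const_mul (r n : ℂ))
    have e : q n = (fun t => (β - s) * (θ (r n * t) * Complex.exp (-(s * t)))) +
        fun t => r n * (deriv θ (r n * t) * Complex.exp (-(s * t))) := by
      ext t; simp only [q, Pi.add_apply]; ring
    rw [e, this.deriv]
    simp only [q']
    ring
  have qs : ∀ n, ContDiff ℝ (⊤ : ℕ∞) (q n) ∧ HasCompactSupport (q n) := fun n => by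
    rw [← hq n]
    have := cut_mem s (r n) (r0 n).ne' h h2
    exact q_smooth β this.1 this.2
  have hz : Filter.Tendsto (fun n => sys.S.Z p (q n)) Filter.atTop
      (𝓝 (sys.S.Z p (fun t => (β - s) * Complex.exp (-(s * t))))) := by
    refine sys.S.Z_tendsto p s hs q _ (fun n => (qs n).1.continuous) (‖β - s‖ * D0 + 1 * D1) ?_ ?_
    · intro n t _
      rw [norm_mul, norm_E]
      refine mul_le_mul_of_nonneg_right ?_ (Real.exp_pos _).le
      refine (norm_add_le _ _).trans ?_
      rw [norm_mul, norm_mul]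
      gcongr
      exacts [hD0 _, rn n, hD1 _]
    · intro t _
      have := (((lim θ h.continuous t).const_mul (β - s)).add
        (rlc.mul (lim _ k1.continuous t))).mul_const (Complex.exp (-(s * t)))
      simpa [h0] using this
  have hz' : Filter.Tendsto (fun n => sys.S.Z p (q' n)) Filter.atTop
      (𝓝 (sys.S.Z p (fun t => (-s) * ((β - s) * Complex.exp (-(s * t)))))) := by
    refine sys.S.Z_tendsto p s hs q' _ (fun n => by
      rw [← hq']; exact (smooth_deriv (qs n).1).continuous)
      (‖β - s‖ * (1 * D1 + ‖s‖ * D0) + 1 * (1 * D2 + ‖s‖ * D1)) ?_ ?_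
    · intro n t _
      have p0 : 0 ≤ D0 := (norm_nonneg _).trans (hD0 0)
      have p1 : 0 ≤ D1 := (norm_nonneg _).trans (hD1 0)
      have p2 : 0 ≤ D2 := (norm_nonneg _).trans (hD2 0)
      rw [norm_mul, norm_E]
      refine mul_le_mul_of_nonneg_right ?_ (Real.exp_pos _).le
      refine (norm_add_le _ _).trans ?_
      rw [norm_mul, norm_mul]
      gcongr
      · refine (norm_sub_le _ _).trans ?_
        rw [norm_mul, norm_mul]
        gcongr
        exacts [rn n, hD1 _, hD0 _]
      · exact rn n
      · refine (norm_sub_le _ _).trans ?_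
        rw [norm_mul, norm_mul]
        gcongr
        exacts [rn n, hD2 _, hD1 _]
    · intro t _
      have a1 := (rlc.mul (lim _ k1.continuous t)).sub ((lim θ h.continuous t).const_mul s)
      have a2 := (rlc.mul (lim _ k2.continuous t)).sub ((lim _ k1.continuous t).const_mul s)
      have := ((a1.const_mul (β - s)).add (rlc.mul a2)).mul_const (Complex.exp (-(s * t)))
      convert this using 2
      rw [h0]; ring
  have hz'' : sys.S.Z p (fun t => (-s) * ((β - s) * Complex.exp (-(s * t))))
      = (-s) • sys.S.Z p (fun t => (β - s) * Complex.exp (-(s * t))) := by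
    rw [C0Semigroup.Z, C0Semigroup.Z, ← integral_smul]
    simp only [smul_smul]
  set z := sys.S.Z p (fun t => (β - s) * Complex.exp (-(s * t))) with hzdef
  rw [hz''] at hz'
  have hA : ∀ n, sys.Am1 (sys.S.Z p (q n)) = sys.ι (-(q n 0 • p) - sys.S.Z p (q' n)) := fun n => by
    rw [sys.Am1_Z p _ (qs n).1 (qs n).2, hq']
  have hq0 : Filter.Tendsto (fun n => q n 0) Filter.atTop (𝓝 (β - s)) := by
    have := (((lim θ h.continuous 0).const_mul (β - s)).add
        (rlc.mul (lim _ k1.continuous 0))).mul_const (Complex.exp (-(s * (0 : ℝ))))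
    simpa [q, h0] using this
  have hw : Filter.Tendsto (fun n => -(q n 0 • p) - sys.S.Z p (q' n)) Filter.atTop
      (𝓝 (-((β - s) • p) - (-s) • z)) := ((hq0.smul_const p).neg).sub hz'
  have hAz : sys.Am1 z = sys.ι (-((β - s) • p) - (-s) • z) := by
    refine tendsto_nhds_unique ((sys.Am1.continuous.tendsto _).comp hz) ?_
    have := (sys.ι.continuous.tendsto _).comp hw
    refine this.congr fun n => ?_
    exact (hA n).symm
  have hzr : z = sys.R s (sys.B v) - p := by
    have e1 := sys.R_left s hs z
    have e2 : s • sys.ι z - sys.Am1 z = (β - s) • sys.ι p := by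
      rw [hAz]
      simp only [map_sub, map_neg, map_smul, neg_smul]
      abel
    have e3 := sys.R_left s hs p
    have e4 := sys.R_right β sys.beta_re (sys.B v)
    rw [← hp] at e4
    have e5 : (β - s) • sys.ι p = sys.B v - (s • sys.ι p - sys.Am1 p) := by
      rw [← e4, sub_smul]; abel
    rw [← e1, e2, e5, map_sub, e3]
  have hC := sys.Cop_tendsto hA hAz hz hw
  have hG := sys.G_shift s β hs sys.beta_re v
  rw [← hp, ← hzr] at hG
  have : sys.G s v = sys.Cop z + (1 : ℂ) • sys.G β v := by rw [← hG]; simp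
  rw [this]
  refine (hC.add_const ((1 : ℂ) • sys.G β v)).congr fun n => ?_
  rw [SystemNode.lam, ← hβ, hq n, ← hp]
  simp [h0]

end laplace

section kernel

variable {U X Xm1 Y : Type*}
  [NormedAddCommGroup U] [NormedSpace ℂ U]
  [NormedAddCommGroup X] [NormedSpace ℂ X] [CompleteSpace X]
  [NormedAddCommGroup Xm1] [NormedSpace ℂ Xm1] [CompleteSpace Xm1]
  [NormedAddCommGroup Y] [NormedSpace ℂ Y]
  (sys : SystemNode U X Xm1 Y)

theorem exists_cut : ∃ θ : ℝ → ℂ, ContDiff ℝ (⊤ : ℕ∞) θ ∧ HasCompactSupport θ ∧ θ 0 = 1 := by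
  let f : ContDiffBump (0 : ℝ) := ⟨1, 2, one_pos, one_lt_two⟩
  refine ⟨fun x => (f x : ℂ), Complex.ofRealCLM.contDiff.comp f.contDiff,
    f.hasCompactSupport.comp_left (g := fun x : ℝ => (x : ℂ)) (by simp), ?_⟩
  have : f 0 = 1 := f.one_of_mem_closedBall (by simp [f])
  simp [this]

theorem exists_polar (μ : Measure ℝ) (h0 : μ (Iio 0) = 0) (K : ℝ → U →L[ℂ] Y)
    (hK : Integrable K μ) : ∃ h : BVMeasure U Y,
      ∀ (S : Set ℝ), MeasurableSet S → ∀ L : ℝ → (U →L[ℂ] Y) → Y,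
        (∀ t (a : ℂ) T, L t (a • T) = a • L t T) →
        ∫ t in S, L t (h.g t) ∂h.μ = ∫ t in S, L t (K t) ∂μ := by
  have hm : AEMeasurable (fun t => ‖K t‖₊) μ := hK.1.nnnorm.aemeasurable
  have hac := withDensity_absolutelyContinuous μ (fun t => (‖K t‖₊ : ℝ≥0∞))
  have hm' : AEStronglyMeasurable (fun t => ((‖K t‖⁻¹ : ℝ) : ℂ) • K t) μ := by
    have a : AEStronglyMeasurable (fun t => ((‖K t‖⁻¹ : ℝ) : ℂ)) μ :=
      (Complex.measurable_ofReal.comp_aemeasurable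
        hK.1.norm.aemeasurable.inv).aestronglyMeasurable
    exact a.smul hK.1
  refine ⟨⟨μ.withDensity (fun t => (‖K t‖₊ : ℝ≥0∞)), ?_, hac h0,
    fun t => ((‖K t‖⁻¹ : ℝ) : ℂ) • K t, hm'.mono_ac hac, ?_⟩, ?_⟩
  · exact isFiniteMeasure_withDensity (ne_of_lt hK.2)
  · rw [ae_withDensity_iff' hm.coe_nnreal_ennreal]
    refine Filter.Eventually.of_forall fun t ht => ?_
    have : ‖K t‖ ≠ 0 := by simpa using ht
    rw [norm_smul, Complex.norm_real, norm_inv, norm_norm, inv_mul_cancel₀ this]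
  · intro S hS L hL
    simp only
    rw [setIntegral_withDensity_eq_setIntegral_smul₀ hm.restrict _ hS]
    congr 1
    ext t
    rw [hL, NNReal.smul_def, coe_nnnorm, ← Complex.coe_smul, smul_smul, ← Complex.ofReal_mul]
    by_cases h : ‖K t‖ = 0
    · have h1 : K t = 0 := norm_eq_zero.1 h
      have := hL t 0 0
      rw [zero_smul, zero_smul] at this
      rw [h1, this, smul_zero]
    · rw [mul_inv_cancel₀ h]; simp

theorem integrable_sum_sum {I J E : Type*} [Fintype I] [Fintype J] [NormedAddCommGroup E]
    [NormedSpace ℂ E] {μ : Measure ℝ} (k : I × J → ℝ → ℂ) (hk : ∀ ij, Integrable (k ij) μ)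
    (w : I → J → E) : Integrable (fun t => ∑ i, ∑ j, k (i, j) t • w i j) μ :=
  integrable_finsetSum _ fun i _ => integrable_finsetSum _ fun j _ => (hk (i, j)).smul_const (w i j)

theorem SystemNode.exists_K [FiniteDimensional ℂ U] [FiniteDimensional ℂ Y]
    (hb : sys.CInfBIBOStable) :
    ∃ (μ : Measure ℝ) (K : ℝ → U →L[ℂ] Y), μ (Iio 0) = 0 ∧ Integrable K μ ∧
      ∀ i (φ : testSp), sys.lam (Module.finBasis ℂ U i) φ
        = ∫ t, (φ : ℝ → ℂ) t • K t (Module.finBasis ℂ U i) ∂μ := by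
  have : CompleteSpace Y := FiniteDimensional.complete ℂ Y
  set bU := Module.finBasis ℂ U with hbU
  set bY := Module.finBasis ℂ Y with hbY
  obtain ⟨c, hc⟩ := sys.lam_bound hb
  let cU := fun i => LinearMap.toContinuousLinearMap (bU.coord i)
  let cY := fun j => LinearMap.toContinuousLinearMap (bY.coord j)
  let l : (Fin (Module.finrank ℂ U) × Fin (Module.finrank ℂ Y)) → testSp →ₗ[ℂ] ℂ := fun ij =>
    { toFun := fun ψ => cY ij.2 (sys.lam (bU ij.1) ψ)
      map_add' := fun a b => by rw [sys.lam_add, map_add]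
      map_smul' := fun a b => by rw [sys.lam_smul, map_smul]; rfl }
  obtain ⟨μ, hμ, h0, k, hk⟩ := rep_final l (fun ij => ‖cY ij.2‖ * (c * ‖bU ij.1‖))
    (fun ij φ M hM => by
      refine ((cY ij.2).le_opNorm _).trans ?_
      rw [mul_assoc]
      refine mul_le_mul_of_nonneg_left ?_ (norm_nonneg _)
      refine (hc (bU ij.1) φ M hM).trans (le_of_eq (by ring)))
    (fun ij φ h => by
      change cY ij.2 (sys.lam (bU ij.1) φ) = 0
      rw [sys.lam_supp _ _ h, map_zero])
  have hint : Integrable (fun t => ∑ i, ∑ j, k (i, j) t • (cU i).smulRight (bY j)) μ :=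
    integrable_sum_sum k (fun ij => (hk ij).1) (fun i j => (cU i).smulRight (bY j))
  refine ⟨μ, fun t => ∑ i, ∑ j, k (i, j) t • (cU i).smulRight (bY j), h0, hint, ?_⟩
  · intro i φ
    have e : ∀ t, (∑ i', ∑ j, k (i', j) t • (cU i').smulRight (bY j)) (bU i)
        = ∑ j, k (i, j) t • bY j := by
      intro t
      simp only [ContinuousLinearMap.sum_apply, ContinuousLinearMap.smul_apply,
        ContinuousLinearMap.smulRight_apply]
      rw [Finset.sum_eq_single i]
      · simp [cU]
      · intro b _ hbi
        simp [cU, Finsupp.single_apply, hbi.symm]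
      · simp
    simp only [e, Finset.smul_sum, smul_smul]
    obtain ⟨D, hD⟩ := φ.2.2.exists_bound_of_continuous φ.2.1.continuous
    rw [integral_finsetSum]
    · conv_lhs => rw [← bY.sum_repr (sys.lam (bU i) φ)]
      refine Finset.sum_congr rfl fun j _ => ?_
      rw [integral_smul_const, ← (hk (i, j)).2 φ]
      rfl
    · intro j _
      refine Integrable.smul_const ?_ _
      exact (hk (i, j)).1.bdd_mul φ.2.1.continuous.aestronglyMeasurable
        (Filter.Eventually.of_forall hD)

theorem SystemNode.conv_K [FiniteDimensional ℂ U] (hb : sys.CInfBIBOStable)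
    (μ : Measure ℝ) (K : ℝ → U →L[ℂ] Y) (h0 : μ (Iio 0) = 0) (hK : Integrable K μ)
    (hl : ∀ i (φ : testSp), sys.lam (Module.finBasis ℂ U i) φ
        = ∫ t, (φ : ℝ → ℂ) t • K t (Module.finBasis ℂ U i) ∂μ)
    (u : ℝ → U) (x : ℝ → X) (y : ℝ → Y) (hsol : sys.IsClassicalSolution u x y) (hx : x 0 = 0)
    (hu : ContDiff ℝ (⊤ : ℕ∞) u) (hu2 : HasCompactSupport u) (hu3 : tsupport u ⊆ Ioi 0)
    (t : ℝ) (ht : 0 ≤ t) : y t = ∫ s in Icc 0 t, K s (u (t - s)) ∂μ := by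
  set bU := Module.finBasis ℂ U with hbU
  let cU := fun i => LinearMap.toContinuousLinearMap (bU.coord i)
  let g : Fin (Module.finrank ℂ U) → testSp := fun i => ⟨fun t => cU i (u t),
    ((cU i).restrictScalars ℝ).contDiff.comp hu, hu2.comp_left (map_zero (cU i))⟩
  have hg : ∀ i, tsupport (g i : ℝ → ℂ) ⊆ Ioi 0 := fun i =>
    (closure_mono (Function.support_comp_subset (map_zero (cU i)) u)).trans hu3
  have hue : ∀ t, ∑ i, (g i : ℝ → ℂ) t • bU i = u t := fun t => bU.sum_repr (u t)
  choose xs hxs hxs0 using fun i => sys.exists_solution (bU i) (g i) (hg i)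
  have hsum := sys.sol_sum Finset.univ _ _ _ hxs
  simp only [hue] at hsum
  rw [sys.sol_unique hb hsol hsum hx (by simp [hxs0]) t ht]
  have step : ∀ i, sys.lam (bU i) (fun s => (g i : ℝ → ℂ) (t - s))
      = ∫ s, (g i : ℝ → ℂ) (t - s) • K s (bU i) ∂μ := fun i =>
    hl i ⟨fun s => (g i : ℝ → ℂ) (t - s), (g i).2.1.comp (contDiff_const.sub contDiff_id),
      (g i).2.2.comp_homeomorph (Homeomorph.subLeft t)⟩
  simp only [step]
  rw [← integral_finsetSum]
  · rw [setIntegral_eq_integral_of_ae_compl_eq_zero]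
    · congr 1
      ext s
      rw [← hue (t - s), map_sum]
      simp only [map_smul]
    · have : ∀ᵐ s ∂μ, s ∉ Iio (0:ℝ) := measure_eq_zero_iff_ae_notMem.1 h0
      filter_upwards [this] with s hs hs'
      have hs1 : t < s := by
        by_contra hcon
        exact hs' ⟨not_lt.1 hs, not_lt.1 hcon⟩
      have : u (t - s) = 0 := image_eq_zero_of_notMem_tsupport fun h => by
        have : 0 < t - s := hu3 h
        linarith
      rw [this, map_zero]
  · intro i _
    obtain ⟨D, hD⟩ := (g i).2.2.exists_bound_of_continuous (g i).2.1.continuous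
    have hKb : Integrable (fun s => K s (bU i)) μ :=
      (ContinuousLinearMap.apply ℂ Y (bU i)).integrable_comp hK
    refine hKb.bdd_smul D (φ := fun s => (g i : ℝ → ℂ) (t - s)) ?_ (Filter.Eventually.of_forall fun s => hD _)
    exact ((g i).2.1.continuous.comp (by fun_prop)).aestronglyMeasurable

theorem SystemNode.laplace_K [FiniteDimensional ℂ U]
    (μ : Measure ℝ) (K : ℝ → U →L[ℂ] Y) (h0 : μ (Iio 0) = 0) (hK : Integrable K μ)
    (hl : ∀ i (φ : testSp), sys.lam (Module.finBasis ℂ U i) φ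
        = ∫ t, (φ : ℝ → ℂ) t • K t (Module.finBasis ℂ U i) ∂μ)
    (s : ℂ) (hs : sys.S.growthBound < s.re) (hs0 : 0 ≤ s.re) (u : U) :
    ∫ t, Complex.exp (-(s * t)) • K t u ∂μ = sys.G s u := by
  set bU := Module.finBasis ℂ U with hbU
  have hnn : ∀ᵐ t ∂μ, t ∉ Iio (0:ℝ) := measure_eq_zero_iff_ae_notMem.1 h0
  have hE : ∀ t : ℝ, t ∉ Iio (0:ℝ) → ‖Complex.exp (-(s * t))‖ ≤ 1 := fun t ht => by
    rw [norm_E, Real.exp_le_one_iff]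
    have := mul_nonneg hs0 (not_lt.1 ht)
    linarith
  have hKb : ∀ v, Integrable (fun t => K t v) μ := fun v =>
      (ContinuousLinearMap.apply ℂ Y v).integrable_comp hK
  have hi : ∀ v, Integrable (fun t : ℝ => Complex.exp (-(s * t)) • K t v) μ := fun v =>
    (hKb v).bdd_smul 1 (φ := fun t : ℝ => Complex.exp (-(s * t)))
      (contDiff_E s).continuous.aestronglyMeasurable (hnn.mono hE)
  obtain ⟨θ, hθ, hθ2, hθ0⟩ := exists_cut
  obtain ⟨D, hD⟩ := hθ2.exists_bound_of_continuous hθ.continuous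
  have hD0 : 0 ≤ D := (norm_nonneg _).trans (hD 0)
  have basis : ∀ i, ∫ t, Complex.exp (-(s * t)) • K t (bU i) ∂μ = sys.G s (bU i) := by
    intro i
    let r : ℕ → ℝ := fun n => 1 / ((n : ℝ) + 1)
    have rl : Filter.Tendsto r Filter.atTop (𝓝 0) := tendsto_one_div_add_atTop_nhds_zero_nat
    have r0 : ∀ n, 0 < r n := fun n => by positivity
    have lim1 := sys.lam_cut_tendsto (bU i) s hs hθ hθ2 hθ0 r r0 (fun n => by
        simp only [r]
        rw [div_le_one (by positivity)]
        have : (0:ℝ) ≤ n := n.cast_nonneg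
        linarith) rl
    refine tendsto_nhds_unique ?_ lim1
    have e : ∀ n, sys.lam (bU i) (fun t : ℝ => θ (r n * t) * Complex.exp (-(s * t)))
        = ∫ t, (θ (r n * t) * Complex.exp (-(s * t))) • K t (bU i) ∂μ := fun n =>
      hl i ⟨_, cut_mem s (r n) (r0 n).ne' hθ hθ2⟩
    simp only [e]
    refine tendsto_integral_of_dominated_convergence (fun t => D * ‖K t (bU i)‖) ?_ ?_ ?_ ?_
    · intro n
      exact (cut_mem s (r n) (r0 n).ne' hθ hθ2).1.continuous.aestronglyMeasurable.smul (hKb _).1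
    · exact (hKb _).norm.const_mul D
    · intro n
      filter_upwards [hnn] with t ht
      rw [norm_smul, norm_mul]
      refine mul_le_mul_of_nonneg_right ?_ (norm_nonneg _)
      calc _ ≤ D * 1 := mul_le_mul (hD _) (hE t ht) (norm_nonneg _) hD0
        _ = D := mul_one D
    · refine Filter.Eventually.of_forall fun t => ?_
      have a : Filter.Tendsto (fun n => θ (r n * t)) Filter.atTop (𝓝 (θ (0 * t))) :=
        (hθ.continuous.tendsto (0 * t)).comp (rl.mul_const t)
      rw [zero_mul, hθ0] at a
      have := (a.mul_const (Complex.exp (-(s * t)))).smul_const (K t (bU i))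
      rwa [one_mul] at this
  have hu := bU.sum_repr u
  rw [← hu, map_sum]
  simp only [map_sum, map_smul, Finset.smul_sum]
  rw [integral_finsetSum]
  · refine Finset.sum_congr rfl fun i _ => ?_
    rw [← basis i, ← integral_smul]
    congr 1
    ext t
    rw [smul_comm]
  · intro i _
    have := (hi (bU i)).smul (bU.repr u i)
    refine this.congr (Filter.Eventually.of_forall fun t => ?_)
    simp only [Pi.smul_apply]
    rw [smul_comm]

end kernel


/-- Proposition 3.7: a `C^∞`-BIBO stable system node with
finite-dimensional input and output spaces admits a measure `h` of bounded total
variation on `[0,∞)` such that every classical solution with smooth, compactly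
supported input and zero initial state satisfies `y = h ∗ u`, and such that the
Laplace transform of `h` equals the transfer function on `ℂ_{ω(T)}`. -/
theorem cInfBIBO_exists_convolution_kernel
    {U X Xm1 Y : Type*}
    [NormedAddCommGroup U] [NormedSpace ℂ U] [FiniteDimensional ℂ U]
    [NormedAddCommGroup X] [NormedSpace ℂ X] [CompleteSpace X]
    [NormedAddCommGroup Xm1] [NormedSpace ℂ Xm1] [CompleteSpace Xm1]
    [NormedAddCommGroup Y] [NormedSpace ℂ Y] [FiniteDimensional ℂ Y]
    (sys : SystemNode U X Xm1 Y)
    (hbibo : sys.CInfBIBOStable) :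
    ∃ h : BVMeasure U Y,
      (∀ (u : ℝ → U) (x : ℝ → X) (y : ℝ → Y),
        sys.IsClassicalSolution u x y → x 0 = 0 →
        ContDiff ℝ (⊤ : ℕ∞) u → HasCompactSupport u → tsupport u ⊆ Set.Ioi 0 →
        ∀ t : ℝ, 0 ≤ t → y t = h.conv u t) ∧
      LaplaceMatches sys h := by
  obtain ⟨μ, K, h0, hK, hl⟩ := sys.exists_K hbibo
  obtain ⟨h, hh⟩ := exists_polar μ h0 K hK
  refine ⟨h, fun u x y hsol hx hu hu2 hu3 t ht => ?_, fun s hs hs0 u => ?_⟩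
  · rw [BVMeasure.conv, sys.conv_K hbibo μ K h0 hK hl u x y hsol hx hu hu2 hu3 t ht]
    exact (hh (Icc 0 t) measurableSet_Icc (fun s T => T (u (t - s))) (fun _ _ _ => rfl)).symm
  · rw [BVMeasure.laplace, ← sys.laplace_K μ K h0 hK hl s hs hs0 u]
    have := hh univ MeasurableSet.univ (fun t T => Complex.exp (-(s * t)) • T u) (fun t a T => by
      rw [smul_apply, smul_comm])
    simpa only [Measure.restrict_univ] using this
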